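/- arXiv:1611.07066 — 2 statements merged into one kernel-verified Lean document; each statement's English description precedes it below -/
import Mathlib

section
/- On the unit sphere S³ with a bi-invariant metric (so that S³ is a Lie subgroup of its isometry group O(4)), the S³-invariant vector fields are exactly the left invariant vector fields, they are eigenvector fields of the rough Laplacian −div∇, and they do not realize the infimum of the energy functional F: every nonzero left invariant vector field X satisfies F(X) = 2, while the infimum of F on all smooth vector fields of S³ is 1. -/
open MeasureTheory Metric Quaternion
open scoped RealInnerProductSpace

noncomputable instance : MeasurableSpace (Quaternion ℝ) := borel _
instance : BorelSpace (Quaternion ℝ) := ⟨rfl⟩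

noncomputable section

/-- The unit sphere `S³` in the quaternions `ℍ ≅ ℝ⁴`, with its (bi-invariant) round
metric; it is a Lie group under quaternion multiplication. -/
def S3 : Set (Quaternion ℝ) := sphere (0 : Quaternion ℝ) 1

/-- Orthogonal projection onto the tangent space of `S³` at `p`. -/
def tprojH (p u : Quaternion ℝ) : Quaternion ℝ := u - ⟪u, p⟫ • p

/-- Covariant derivative (Levi–Civita connection of `S³`) of `X` at `p` in the
direction `u`. -/
def covDH (X : Quaternion ℝ → Quaternion ℝ) (p u : Quaternion ℝ) : Quaternion ℝ :=
  tprojH p (fderiv ℝ X p (tprojH p u))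

/-- Pointwise squared norm `‖∇X‖²` of the covariant derivative. -/
def covNormSqH (X : Quaternion ℝ → Quaternion ℝ) (p : Quaternion ℝ) : ℝ :=
  ∑ i, ‖covDH X p (stdOrthonormalBasis ℝ (Quaternion ℝ) i)‖ ^ 2

/-- The Riemannian volume of `S³`: 3-dimensional Hausdorff measure on the sphere. -/
def smeasureH : Measure (Quaternion ℝ) := (μH[(3 : ℝ)]).restrict S3

/-- The energy functional `F(X) = (∫‖∇X‖²)/(∫‖X‖²)` on vector fields of `S³`. -/
def energyH (X : Quaternion ℝ → Quaternion ℝ) : ℝ :=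
  (∫ p, covNormSqH X p ∂smeasureH) / (∫ p, ‖X p‖ ^ 2 ∂smeasureH)

/-- Tangency of an (ambiently extended) vector field along `S³`. -/
def IsTangentH (X : Quaternion ℝ → Quaternion ℝ) : Prop := ∀ p ∈ S3, ⟪X p, p⟫ = 0

/-- `X` is `S³`-invariant for the isometric action of the Lie group `S³` on itself by
left translations: `X(g·p) = d(L_g)_p(X(p))`. -/
def IsS3Invariant (X : Quaternion ℝ → Quaternion ℝ) : Prop :=
  ∀ g ∈ S3, ∀ p ∈ S3, X (g * p) = fderiv ℝ (fun q : Quaternion ℝ => g * q) p (X p)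

/-- `X` is a left invariant vector field of the Lie group `S³`. -/
def IsLeftInvariantH (X : Quaternion ℝ → Quaternion ℝ) : Prop :=
  ∀ g ∈ S3, ∀ p ∈ S3, X (g * p) = g * X p

/-- The rough Laplacian `div∇X` on `S³` (trace of the second covariant derivative). -/
def roughLapH (X : Quaternion ℝ → Quaternion ℝ) (p : Quaternion ℝ) : Quaternion ℝ :=
  ∑ i, tprojH p
    (fderiv ℝ (fun q => covDH X q (stdOrthonormalBasis ℝ (Quaternion ℝ) i)) p
      (tprojH p (stdOrthonormalBasis ℝ (Quaternion ℝ) i)))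

end


/-- quaternion with given components -/
def qmk (a b c d : ℝ) : ℍ[ℝ] := ⟨a, b, c, d⟩
@[simp] lemma qmk_re (a b c d : ℝ) : (qmk a b c d).re = a := rfl
@[simp] lemma qmk_imI (a b c d : ℝ) : (qmk a b c d).imI = b := rfl
@[simp] lemma qmk_imJ (a b c d : ℝ) : (qmk a b c d).imJ = c := rfl
@[simp] lemma qmk_imK (a b c d : ℝ) : (qmk a b c d).imK = d := rfl

/-- derivative along the left invariant field `p * a` -/
noncomputable def D (a : ℍ[ℝ]) (f : ℍ[ℝ] → ℝ) (p : ℍ[ℝ]) : ℝ := fderiv ℝ f p (p * a)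

lemma mem_S3_iff {p : ℍ[ℝ]} : p ∈ S3 ↔ p.re^2+p.imI^2+p.imJ^2+p.imK^2 = 1 := by
  have h : ‖p‖ * ‖p‖ = p.re^2+p.imI^2+p.imJ^2+p.imK^2 := by
    rw [← Quaternion.normSq_eq_norm_mul_self, Quaternion.normSq_def']
  unfold S3
  rw [mem_sphere_zero_iff_norm, ← h]
  constructor
  · intro h; rw [h]; norm_num
  · intro h'; nlinarith [norm_nonneg p]

lemma norm_S3 {p : ℍ[ℝ]} (hp : p ∈ S3) : ‖p‖ = 1 := by
  simpa [S3] using hp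

lemma mul_S3 {p q : ℍ[ℝ]} (hp : p ∈ S3) (hq : q ∈ S3) : p * q ∈ S3 := by
  have := norm_S3 hp; have := norm_S3 hq
  simp_all [S3]

lemma star_S3 {p : ℍ[ℝ]} (hp : p ∈ S3) : star p ∈ S3 := by
  have := norm_S3 hp
  simp_all [S3]

lemma one_S3 : (1 : ℍ[ℝ]) ∈ S3 := by simp [S3]

lemma star_mul_S3 {p : ℍ[ℝ]} (hp : p ∈ S3) : star p * p = 1 := by
  rw [Quaternion.star_mul_self, Quaternion.normSq_eq_norm_mul_self, norm_S3 hp]; simp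

lemma mul_star_S3 {p : ℍ[ℝ]} (hp : p ∈ S3) : p * star p = 1 := by
  rw [Quaternion.self_mul_star, Quaternion.normSq_eq_norm_mul_self, norm_S3 hp]; simp

lemma compact_S3 : IsCompact S3 := isCompact_sphere _ _

lemma norm_sq_q (p : ℍ[ℝ]) : ‖p‖^2 = p.re^2+p.imI^2+p.imJ^2+p.imK^2 := by
  rw [pow_two, ← Quaternion.normSq_eq_norm_mul_self, Quaternion.normSq_def']

lemma inner_q (p q : ℍ[ℝ]) : ⟪p, q⟫ = p.re*q.re+p.imI*q.imI+p.imJ*q.imJ+p.imK*q.imK := by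
  rw [Quaternion.inner_def]; simp; try ring

lemma measurableSet_S3 : MeasurableSet S3 := compact_S3.isClosed.measurableSet

/-! Invariance -/
lemma mp_right {g : ℍ[ℝ]} (hg : g ∈ S3) :
    MeasurePreserving (fun p : ℍ[ℝ] => p * g) smeasureH smeasureH := by
  let e : ℍ[ℝ] ≃ᵢ ℍ[ℝ] := ⟨⟨fun p => p * g, fun p => p * star g,
    fun p => by simp [mul_assoc, mul_star_S3 hg], fun p => by simp [mul_assoc, star_mul_S3 hg]⟩, by
      apply Isometry.of_dist_eq
      intro x y
      simp [dist_eq_norm, ← sub_mul, norm_S3 hg]⟩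
  have h := (e.measurePreserving_hausdorffMeasure 3).restrict_preimage measurableSet_S3
  have h2 : e ⁻¹' S3 = S3 := by
    ext p
    simp [e, S3, norm_S3 hg]
  rw [h2] at h
  exact h

lemma mp_left {g : ℍ[ℝ]} (hg : g ∈ S3) :
    MeasurePreserving (fun p : ℍ[ℝ] => g * p) smeasureH smeasureH := by
  let e : ℍ[ℝ] ≃ᵢ ℍ[ℝ] := ⟨⟨fun p => g * p, fun p => star g * p,
    fun p => by simp [← mul_assoc, star_mul_S3 hg], fun p => by simp [← mul_assoc, mul_star_S3 hg]⟩, by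
      apply Isometry.of_dist_eq
      intro x y
      simp [dist_eq_norm, ← mul_sub, norm_S3 hg]⟩
  have h := (e.measurePreserving_hausdorffMeasure 3).restrict_preimage measurableSet_S3
  have h2 : e ⁻¹' S3 = S3 := by
    ext p
    simp [e, S3, norm_S3 hg]
  rw [h2] at h
  exact h

lemma cd_re : ContDiff ℝ (⊤ : ℕ∞) (fun p : ℍ[ℝ] => p.re) := by
  have : (fun p : ℍ[ℝ] => p.re) = fun p => ⟪p, (1 : ℍ[ℝ])⟫ := by ext p; simp [inner_q]
  rw [this]; exact contDiff_id.inner ℝ contDiff_const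
lemma cd_imI : ContDiff ℝ (⊤ : ℕ∞) (fun p : ℍ[ℝ] => p.imI) := by
  have : (fun p : ℍ[ℝ] => p.imI) = fun p => ⟪p, qmk 0 1 0 0⟫ := by ext p; simp [inner_q]
  rw [this]; exact contDiff_id.inner ℝ contDiff_const
lemma cd_imJ : ContDiff ℝ (⊤ : ℕ∞) (fun p : ℍ[ℝ] => p.imJ) := by
  have : (fun p : ℍ[ℝ] => p.imJ) = fun p => ⟪p, qmk 0 0 1 0⟫ := by ext p; simp [inner_q]
  rw [this]; exact contDiff_id.inner ℝ contDiff_const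
lemma cd_imK : ContDiff ℝ (⊤ : ℕ∞) (fun p : ℍ[ℝ] => p.imK) := by
  have : (fun p : ℍ[ℝ] => p.imK) = fun p => ⟪p, qmk 0 0 0 1⟫ := by ext p; simp [inner_q]
  rw [this]; exact contDiff_id.inner ℝ contDiff_const

lemma quat_decomp (a b c d : ℝ) : qmk a b c d = a • (1 : ℍ[ℝ]) + b • qmk 0 1 0 0
    + c • qmk 0 0 1 0 + d • qmk 0 0 0 1 := by
  ext <;> simp

/-! Measure finite, nonzero -/
lemma meas_lt_top : (μH[(3:ℝ)] : Measure ℍ[ℝ]) S3 < ⊤ := by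
  let f : (Fin 3 → ℝ) → ℍ[ℝ] := fun v => qmk (Real.cos (v 0) * Real.cos (v 1))
    (Real.cos (v 0) * Real.sin (v 1)) (Real.sin (v 0) * Real.cos (v 2)) (Real.sin (v 0) * Real.sin (v 2))
  have hf : ContDiff ℝ 1 f := by
    have h : f = fun v => _ := funext fun v => quat_decomp _ _ _ _
    rw [h]
    fun_prop
  let K : Set (Fin 3 → ℝ) := Set.Icc (fun _ => -Real.pi) (fun _ => Real.pi)
  have hK : IsCompact K := isCompact_Icc
  obtain ⟨C, hC⟩ := hf.contDiffOn.exists_lipschitzOnWith one_ne_zero (convex_Icc _ _) hK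
  have h1 := hC.hausdorffMeasure_image_le (d := 3) (by norm_num)
  have hsub : S3 ⊆ f '' K := by
    intro p hp
    rw [mem_S3_iff] at hp
    let z : ℂ := ⟨p.re, p.imI⟩
    let w : ℂ := ⟨p.imJ, p.imK⟩
    have hz : ‖z‖^2 = p.re^2 + p.imI^2 := by rw [Complex.sq_norm, Complex.normSq_mk]; ring
    have hw : ‖w‖^2 = p.imJ^2 + p.imK^2 := by rw [Complex.sq_norm, Complex.normSq_mk]; ring
    have hz1 : ‖z‖ ≤ 1 := by
      rw [← sq_le_one_iff₀ (norm_nonneg _)]; nlinarith [sq_nonneg p.imJ, sq_nonneg p.imK]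
    have hc : Real.cos (Real.arccos ‖z‖) = ‖z‖ :=
      Real.cos_arccos (by linarith [norm_nonneg z]) hz1
    have hs : Real.sin (Real.arccos ‖z‖) = ‖w‖ := by
      rw [Real.sin_arccos, show 1 - ‖z‖^2 = ‖w‖^2 by linarith, Real.sqrt_sq (norm_nonneg _)]
    refine ⟨![Real.arccos ‖z‖, z.arg, w.arg], ?_, ?_⟩
    · constructor <;> intro i <;> fin_cases i <;> simp
      · linarith [Real.arccos_nonneg ‖z‖, Real.pi_pos]
      · exact (Complex.neg_pi_lt_arg _).le
      · exact (Complex.neg_pi_lt_arg _).le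
      · exact Real.arccos_le_pi _
      · exact Complex.arg_le_pi _
      · exact Complex.arg_le_pi _
    · ext <;> simp [f, hc, hs] <;> rfl
  refine (measure_mono hsub).trans_lt (h1.trans_lt ?_)
  refine ENNReal.mul_lt_top (by simp) ?_
  have h2 : (μH[(3:ℝ)] : Measure (Fin 3 → ℝ)) = volume := by
    simpa using (hausdorffMeasure_pi_real (ι := Fin 3))
  rw [h2]
  exact hK.measure_lt_top

lemma meas_pos : 0 < (μH[(3:ℝ)] : Measure ℍ[ℝ]) S3 := by
  let f : ℍ[ℝ] → (Fin 3 → ℝ) := fun p => ![p.imI, p.imJ, p.imK]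
  have hf : LipschitzWith 1 f := by
    apply LipschitzWith.of_dist_le_mul
    intro p q
    rw [dist_pi_le_iff (by positivity)]
    have hn := norm_sq_q (p - q)
    simp at hn
    intro i
    fin_cases i <;> simp [f, dist_eq_norm] <;> apply abs_le_of_sq_le_sq _ (norm_nonneg _) <;> rw [hn] <;> nlinarith [sq_nonneg (p.re - q.re), sq_nonneg (p.imI - q.imI), sq_nonneg (p.imJ - q.imJ), sq_nonneg (p.imK - q.imK)]
  have h1 := (hf.lipschitzOnWith (s := S3)).hausdorffMeasure_image_le (d := 3) (by norm_num)
  have h2 : (μH[(3:ℝ)] : Measure (Fin 3 → ℝ)) = volume := by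
    simpa using (hausdorffMeasure_pi_real (ι := Fin 3))
  rw [h2] at h1
  have hsub : ball (0 : Fin 3 → ℝ) (1/2) ⊆ f '' S3 := by
    intro v hv
    rw [mem_ball_zero_iff, pi_norm_lt_iff (by norm_num)] at hv
    have h0 := abs_lt.1 (hv 0); have h1 := abs_lt.1 (hv 1); have h2 := abs_lt.1 (hv 2)
    refine ⟨qmk (Real.sqrt (1 - v 0^2 - v 1^2 - v 2^2)) (v 0) (v 1) (v 2), ?_, ?_⟩
    · rw [mem_S3_iff]
      simp only [qmk_re, qmk_imI, qmk_imJ, qmk_imK]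
      rw [Real.sq_sqrt]
      · ring
      · nlinarith
    · ext i; fin_cases i <;> simp [f]
  have h3 : 0 < volume (ball (0 : Fin 3 → ℝ) (1/2)) := measure_ball_pos _ _ (by norm_num)
  have := (h3.trans_le (measure_mono hsub)).trans_le h1
  simpa using this

instance : IsFiniteMeasure smeasureH := ⟨by
  unfold smeasureH; simpa using meas_lt_top⟩

lemma ae_S3 : ∀ᵐ p ∂smeasureH, p ∈ S3 := ae_restrict_mem measurableSet_S3

lemma cont_integrable {f : ℍ[ℝ] → ℝ} (hf : Continuous f) : Integrable f smeasureH := by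
  obtain ⟨C, hC⟩ := compact_S3.exists_bound_of_continuousOn hf.continuousOn
  exact Integrable.of_bound hf.aestronglyMeasurable C (ae_S3.mono fun p hp => hC p hp)

lemma meas_univ : 0 < smeasureH.real Set.univ := by
  have : smeasureH Set.univ = (μH[(3:ℝ)] : Measure ℍ[ℝ]) S3 := by simp [smeasureH]
  rw [measureReal_def, this]
  exact ENNReal.toReal_pos meas_pos.ne' meas_lt_top.ne

lemma integral_right {g : ℍ[ℝ]} (hg : g ∈ S3) {f : ℍ[ℝ] → ℝ} (hf : Continuous f) :
    ∫ p, f (p * g) ∂smeasureH = ∫ p, f p ∂smeasureH := by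
  have h := mp_right hg
  conv_rhs => rw [← h.map_eq]
  rw [integral_map h.measurable.aemeasurable hf.aestronglyMeasurable]

lemma integral_pos_S3 {f : ℍ[ℝ] → ℝ} (hf : Continuous f) (h0 : ∀ p, 0 ≤ f p) {p : ℍ[ℝ]}
    (hp : p ∈ S3) (hpos : f p ≠ 0) : 0 < ∫ p, f p ∂smeasureH := by
  rw [integral_pos_iff_support_of_nonneg h0 (cont_integrable hf)]
  rw [pos_iff_ne_zero]
  intro hz
  have hU : IsOpen (Function.support f) := hf.isOpen_support
  obtain ⟨t, ht⟩ := compact_S3.elim_finite_subcover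
    (fun g : S3 => (fun q : ℍ[ℝ] => g.1 * q) ⁻¹' (Function.support f))
    (fun g => hU.preimage (by fun_prop)) (by
      intro q hq
      simp only [Set.mem_iUnion]
      refine ⟨⟨p * star q, mul_S3 hp (star_S3 hq)⟩, ?_⟩
      simp [mul_assoc, star_mul_S3 hq, hpos])
  have : smeasureH S3 = 0 := by
    refine measure_mono_null ht ?_
    refine (measure_biUnion_null_iff t.countable_toSet).2 ?_
    intro g _
    rw [(mp_left g.2).measure_preimage hU.measurableSet.nullMeasurableSet, hz]
  have h2 : smeasureH S3 = (μH[(3:ℝ)] : Measure ℍ[ℝ]) S3 := by simp [smeasureH]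
  exact meas_pos.ne' (h2 ▸ this)

/-! Calculus along left invariant fields -/
lemma D_contDiff (a : ℍ[ℝ]) {f : ℍ[ℝ] → ℝ} (hf : ContDiff ℝ (⊤ : ℕ∞) f) :
    ContDiff ℝ (⊤ : ℕ∞) (D a f) := by
  unfold D
  exact (hf.fderiv_right (m := (⊤ : ℕ∞)) (by simp)).clm_apply (contDiff_id.mul contDiff_const)

lemma D_mul (a : ℍ[ℝ]) {f g : ℍ[ℝ] → ℝ} (hf : ContDiff ℝ (⊤ : ℕ∞) f)
    (hg : ContDiff ℝ (⊤ : ℕ∞) g) (p : ℍ[ℝ]) :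
    D a (fun q => f q * g q) p = D a f p * g p + f p * D a g p := by
  have h1 : DifferentiableAt ℝ f p := (hf.differentiable (by simp)).differentiableAt
  have h2 : DifferentiableAt ℝ g p := (hg.differentiable (by simp)).differentiableAt
  unfold D
  rw [fderiv_fun_mul h1 h2]
  simp; ring

lemma D_D (a b : ℍ[ℝ]) {f : ℍ[ℝ] → ℝ} (hf : ContDiff ℝ (⊤ : ℕ∞) f) (p : ℍ[ℝ]) :
    D a (D b f) p = fderiv ℝ (fderiv ℝ f) p (p * a) (p * b) + fderiv ℝ f p (p * a * b) := by
  have h1 : DifferentiableAt ℝ (fderiv ℝ f) p :=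
    ((hf.fderiv_right (m := (⊤ : ℕ∞)) (by simp)).differentiable (by simp)).differentiableAt
  have h2 : HasFDerivAt (fun q : ℍ[ℝ] => q * b) ((ContinuousLinearMap.mul ℝ ℍ[ℝ]).flip b) p :=
    ((ContinuousLinearMap.mul ℝ ℍ[ℝ]).flip b).hasFDerivAt
  have h3 := h1.hasFDerivAt.clm_apply h2
  unfold D
  rw [h3.fderiv]
  simp [add_comm]

lemma D_comm (a b : ℍ[ℝ]) {f : ℍ[ℝ] → ℝ} (hf : ContDiff ℝ (⊤ : ℕ∞) f) (p : ℍ[ℝ]) :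
    D a (D b f) p - D b (D a f) p = D (a * b - b * a) f p := by
  have hs : IsSymmSndFDerivAt ℝ f p := hf.contDiffAt.isSymmSndFDerivAt (by simp; exact WithTop.coe_le_coe.2 (le_top : (2:ℕ∞) ≤ ⊤))
  rw [D_D a b hf, D_D b a hf, hs.eq (p * a) (p * b)]
  unfold D
  rw [mul_sub, map_sub, mul_assoc, mul_assoc]; ring

/-- integral of a derivative vanishes -/
lemma integral_D {a : ℍ[ℝ]} (ha : a * a = -1) (hn : ‖a‖ = 1) (har : a.re = 0) {f : ℍ[ℝ] → ℝ}
    (hf : ContDiff ℝ (⊤ : ℕ∞) f) : ∫ p, D a f p ∂smeasureH = 0 := by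
  let γ : ℝ → ℍ[ℝ] := fun t => Real.cos t • 1 + Real.sin t • a
  have hγc : Continuous γ := by fun_prop
  have hγ3 : ∀ t, γ t ∈ S3 := by
    intro t
    have h := norm_sq_q a
    rw [hn, har] at h
    rw [mem_S3_iff]
    simp [γ, har]
    linear_combination (Real.sin t)^2 * (-h) + Real.sin_sq_add_cos_sq t
  have hγd : ∀ t, HasDerivAt γ (γ t * a) t := by
    intro t
    have h := ((Real.hasDerivAt_cos t).smul_const (1 : ℍ[ℝ])).add
      ((Real.hasDerivAt_sin t).smul_const a)
    have e : γ t * a = -Real.sin t • (1 : ℍ[ℝ]) + Real.cos t • a := by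
      simp [γ, add_mul, ha, add_comm]
    rw [e]
    exact h
  have hDc : Continuous (D a f) := (D_contDiff a hf).continuous
  have hper : ∀ p, ∫ t in (0:ℝ)..(2 * Real.pi), D a f (p * γ t) = 0 := by
    intro p
    have hd : ∀ t, HasDerivAt (fun t => f (p * γ t)) (D a f (p * γ t)) t := by
      intro t
      have h1 : HasFDerivAt f (fderiv ℝ f (p * γ t)) (p * γ t) :=
        (hf.differentiable (by simp)).differentiableAt.hasFDerivAt
      have h2 := h1.comp_hasDerivAt t ((hγd t).const_mul p)
      have e : D a f (p * γ t) = fderiv ℝ f (p * γ t) (p * (γ t * a)) := by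
        unfold D; rw [mul_assoc]
      rw [e]
      exact h2
    rw [intervalIntegral.integral_eq_sub_of_hasDerivAt (fun t _ => hd t)
      (Continuous.intervalIntegrable (by fun_prop) _ _)]
    simp [γ]
  obtain ⟨C, hC⟩ := compact_S3.exists_bound_of_continuousOn hDc.continuousOn
  have hint : Integrable (Function.uncurry fun (p : ℍ[ℝ]) (t : ℝ) => D a f (p * γ t))
      (smeasureH.prod (volume.restrict (Set.Ioc 0 (2 * Real.pi)))) := by
    refine Integrable.of_bound (Continuous.aestronglyMeasurable (by fun_prop)) C ?_
    have h1 : ∀ᵐ z ∂(smeasureH.prod (volume.restrict (Set.Ioc (0:ℝ) (2 * Real.pi)))), z.1 ∈ S3 :=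
      Measure.quasiMeasurePreserving_fst.ae ae_S3
    filter_upwards [h1] with z hz
    exact hC _ (mul_S3 hz (hγ3 _))
  have hsw := integral_integral_swap hint
  have e1 : ∀ p, ∫ t in Set.Ioc (0:ℝ) (2 * Real.pi), D a f (p * γ t) = 0 := by
    intro p
    have h := hper p
    rwa [intervalIntegral.integral_of_le (by positivity)] at h
  simp only [e1, integral_right (hγ3 _) hDc] at hsw
  simp at hsw
  rcases hsw with h | h
  · exact absurd h (not_le.2 (by positivity))
  · exact h

lemma integral_bracket {a b : ℍ[ℝ]} (ha : a * a = -1) (hn : ‖a‖ = 1) (har : a.re = 0)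
    (hb : b * b = -1) (hnb : ‖b‖ = 1) (hbr : b.re = 0) {f g : ℍ[ℝ] → ℝ}
    (hf : ContDiff ℝ (⊤ : ℕ∞) f) (hg : ContDiff ℝ (⊤ : ℕ∞) g) :
    ∫ p, (D a f p * D b g p - D b f p * D a g p + f p * D (a * b - b * a) g p) ∂smeasureH = 0 := by
  have h1 := integral_D ha hn har (hf.mul (D_contDiff b hg))
  have h2 := integral_D hb hnb hbr (hf.mul (D_contDiff a hg))
  have i1 := cont_integrable (D_contDiff a (hf.mul (D_contDiff b hg))).continuous
  have i2 := cont_integrable (D_contDiff b (hf.mul (D_contDiff a hg))).continuous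
  have h3 := integral_sub i1 i2
  rw [h1, h2, sub_zero] at h3
  rw [← h3]
  congr 1
  ext p
  rw [← D_comm a b hg, D_mul a hf (D_contDiff b hg), D_mul b hf (D_contDiff a hg)]
  ring

/-- the unit imaginary quaternions -/
def qi : ℍ[ℝ] := qmk 0 1 0 0
def qj : ℍ[ℝ] := qmk 0 0 1 0
def qk : ℍ[ℝ] := qmk 0 0 0 1

lemma norm_unit {a : ℍ[ℝ]} (h : a.re^2+a.imI^2+a.imJ^2+a.imK^2 = 1) : ‖a‖ = 1 :=
  norm_S3 (mem_S3_iff.2 h)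
lemma qi_n : ‖qi‖ = 1 := norm_unit (by simp [qi])
lemma qj_n : ‖qj‖ = 1 := norm_unit (by simp [qj])
lemma qk_n : ‖qk‖ = 1 := norm_unit (by simp [qk])
lemma qi_r : qi.re = 0 := rfl
lemma qj_r : qj.re = 0 := rfl
lemma qk_r : qk.re = 0 := rfl
lemma qii : qi * qi = -1 := by ext <;> simp [qi]
lemma qjj : qj * qj = -1 := by ext <;> simp [qj]
lemma qkk : qk * qk = -1 := by ext <;> simp [qk]
lemma qij : qi * qj = qk := by ext <;> simp [qi, qj, qk]
lemma qjk : qj * qk = qi := by ext <;> simp [qi, qj, qk]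
lemma qki : qk * qi = qj := by ext <;> simp [qi, qj, qk]
lemma qji : qj * qi = -qk := by ext <;> simp [qi, qj, qk]
lemma qkj : qk * qj = -qi := by ext <;> simp [qi, qj, qk]
lemma qik : qi * qk = -qj := by ext <;> simp [qi, qj, qk]

lemma D_two (a : ℍ[ℝ]) (f : ℍ[ℝ] → ℝ) (p : ℍ[ℝ]) : D (a - -a) f p = 2 * D a f p := by
  unfold D; rw [sub_neg_eq_add, mul_add, map_add]; ring
lemma D_two' (a : ℍ[ℝ]) (f : ℍ[ℝ] → ℝ) (p : ℍ[ℝ]) : D (-a - a) f p = -2 * D a f p := by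
  unfold D; rw [mul_sub, mul_neg, map_sub, map_neg]; ring

lemma integral_le_of_key {A B K : ℍ[ℝ] → ℝ} (hA : Integrable A smeasureH)
    (hB : Integrable B smeasureH) (hK : Integrable K smeasureH) (h : ∫ p, K p ∂smeasureH = 0)
    (hle : ∀ p, B p + K p ≤ A p) : ∫ p, B p ∂smeasureH ≤ ∫ p, A p ∂smeasureH := by
  have := integral_mono (hB.add hK) hA hle
  simp only [Pi.add_apply] at this
  rwa [integral_add hB hK, h, add_zero] at this

/-- the integrated Bochner–Yano inequality in the left invariant frame -/
lemma bochner {x y z : ℍ[ℝ] → ℝ} (hx : ContDiff ℝ (⊤ : ℕ∞) x) (hy : ContDiff ℝ (⊤ : ℕ∞) y)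
    (hz : ContDiff ℝ (⊤ : ℕ∞) z) :
    ∫ p, (x p^2 + y p^2 + z p^2) ∂smeasureH ≤
    ∫ p, (D qi x p^2 + (D qi y p - z p)^2 + (D qi z p + y p)^2
      + (D qj x p + z p)^2 + D qj y p^2 + (D qj z p - x p)^2
      + (D qk x p - y p)^2 + (D qk y p + x p)^2 + D qk z p^2) ∂smeasureH := by
  have c := @D_contDiff
  have hxc := hx.continuous
  have hyc := hy.continuous
  have hzc := hz.continuous
  have cc : ∀ a {f : ℍ[ℝ] → ℝ}, ContDiff ℝ (⊤ : ℕ∞) f → Continuous (D a f) :=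
    fun a f hf => (D_contDiff a hf).continuous
  have xi := cc qi hx
  have xj := cc qj hx
  have xk := cc qk hx
  have yi := cc qi hy
  have yj := cc qj hy
  have yk := cc qk hy
  have zi := cc qi hz
  have zj := cc qj hz
  have zk := cc qk hz
  have h1 := integral_bracket qii qi_n qi_r qjj qj_n qj_r hx hy
  have h2 := integral_bracket qjj qj_n qj_r qii qi_n qi_r hy hx
  have h3 := integral_bracket qjj qj_n qj_r qkk qk_n qk_r hy hz
  have h4 := integral_bracket qkk qk_n qk_r qjj qj_n qj_r hz hy
  have h5 := integral_bracket qkk qk_n qk_r qii qi_n qi_r hz hx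
  have h6 := integral_bracket qii qi_n qi_r qkk qk_n qk_r hx hz
  simp only [qij, qji, qjk, qkj, qki, qik, D_two, D_two'] at h1 h2 h3 h4 h5 h6
  have key : ∫ p, (1/2) * ((D qi x p * D qj y p - D qj x p * D qi y p + x p * (2 * D qk y p))
      + (D qj y p * D qi x p - D qi y p * D qj x p + y p * (-2 * D qk x p))
      + (D qj y p * D qk z p - D qk y p * D qj z p + y p * (2 * D qi z p))
      + (D qk z p * D qj y p - D qj z p * D qk y p + z p * (-2 * D qi y p))
      + (D qk z p * D qi x p - D qi z p * D qk x p + z p * (2 * D qj x p))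
      + (D qi x p * D qk z p - D qk x p * D qi z p + x p * (-2 * D qj z p))) ∂smeasureH = 0 := by
    rw [integral_const_mul, integral_add, integral_add, integral_add, integral_add, integral_add,
      h1, h2, h3, h4, h5, h6]
    · simp
    all_goals exact cont_integrable (by fun_prop)
  refine integral_le_of_key (cont_integrable (by fun_prop)) (cont_integrable (by fun_prop))
    (cont_integrable (by fun_prop)) key fun p => ?_
  generalize D qi x p = a11, D qi y p = a12, D qi z p = a13, D qj x p = a21, D qj y p = a22,
    D qj z p = a23, D qk x p = a31, D qk y p = a32, D qk z p = a33, x p = u, y p = v, z p = w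
  have : 0 ≤ ((a12 - w) - (a21 + w))^2/4 + 3/4 * ((a12 - w) + (a21 + w))^2
      + ((a13 + v) - (a31 - v))^2/4 + 3/4 * ((a13 + v) + (a31 - v))^2
      + ((a23 - u) - (a32 + u))^2/4 + 3/4 * ((a23 - u) + (a32 + u))^2
      + ((a11 - a22)^2 + (a22 - a33)^2 + (a11 - a33)^2)/2 := by positivity
  linarith

/-! Geometry of the sphere -/
lemma fderiv_tang {F G : ℍ[ℝ] → ℍ[ℝ]} {p u : ℍ[ℝ]} (hp : p ∈ S3) (hu : ⟪u, p⟫ = 0)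
    (hF : DifferentiableAt ℝ F p) (hG : DifferentiableAt ℝ G p) (h : ∀ q ∈ S3, F q = G q) :
    fderiv ℝ F p u = fderiv ℝ G p u := by
  by_cases hu0 : u = 0
  · simp [hu0]
  have hs : ‖u‖ ≠ 0 := by simpa using hu0
  let c : ℝ → ℍ[ℝ] := fun t => Real.cos (‖u‖ * t) • p + (Real.sin (‖u‖ * t) * ‖u‖⁻¹) • u
  have hc0 : c 0 = p := by simp [c]
  have hcS : ∀ t, c t ∈ S3 := by
    intro t
    have h1 : ‖c t‖^2 = 1 := by
      simp only [c]
      rw [norm_add_sq_real, inner_smul_left, inner_smul_right, real_inner_comm, hu, norm_smul,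
        norm_smul, norm_S3 hp, mul_pow, mul_pow]
      simp only [Real.norm_eq_abs, sq_abs]
      have h3 : ‖u‖⁻¹^2 * ‖u‖^2 = 1 := by field_simp
      linear_combination Real.sin_sq_add_cos_sq (‖u‖ * t) + Real.sin (‖u‖ * t)^2 * h3
    have h4 : ‖c t‖ = 1 := by nlinarith [norm_nonneg (c t)]
    simpa [S3] using h4
  have hcd : HasDerivAt c u 0 := by
    have h1 : HasDerivAt (fun t : ℝ => ‖u‖ * t) (‖u‖ * 1) 0 := (hasDerivAt_id (0:ℝ)).const_mul _
    have h2 := (h1.cos.smul_const p).add ((h1.sin.mul_const ‖u‖⁻¹).smul_const u)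
    have e : (-Real.sin (‖u‖ * 0) * (‖u‖ * 1)) • p + (Real.cos (‖u‖ * 0) * (‖u‖ * 1) * ‖u‖⁻¹) • u = u := by
      simp [hs]
    rw [e] at h2
    exact h2
  have h1 : HasDerivAt (F ∘ c) (fderiv ℝ F p u) 0 := by
    apply HasFDerivAt.comp_hasDerivAt (0:ℝ) _ hcd
    rw [hc0]; exact hF.hasFDerivAt
  have h2 : HasDerivAt (G ∘ c) (fderiv ℝ G p u) 0 := by
    apply HasFDerivAt.comp_hasDerivAt (0:ℝ) _ hcd
    rw [hc0]; exact hG.hasFDerivAt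
  have e : F ∘ c = G ∘ c := funext fun t => h _ (hcS t)
  rw [e] at h1
  exact h1.unique h2

lemma inner_mul_left_S3 {p : ℍ[ℝ]} (hp : p ∈ S3) (u v : ℍ[ℝ]) : ⟪p * u, p * v⟫ = ⟪u, v⟫ := by
  rw [mem_S3_iff] at hp
  simp only [inner_q, Quaternion.re_mul, Quaternion.imI_mul, Quaternion.imJ_mul, Quaternion.imK_mul]
  linear_combination (u.re * v.re + u.imI * v.imI + u.imJ * v.imJ + u.imK * v.imK) * hp

lemma inner_mul_left_S3' {p : ℍ[ℝ]} (hp : p ∈ S3) (u : ℍ[ℝ]) : ⟪p * u, p⟫ = u.re := by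
  have := inner_mul_left_S3 hp u 1
  rw [mul_one] at this
  rw [this]; simp [inner_q]

/-- orthonormal frame `p, p i, p j, p k` -/
noncomputable def frame (p : ℍ[ℝ]) (hp : p ∈ S3) : OrthonormalBasis (Fin 4) ℝ ℍ[ℝ] :=
  have ho : Orthonormal ℝ ![p * 1, p * qi, p * qj, p * qk] := by
    rw [orthonormal_iff_ite]
    intro i j
    fin_cases i <;> fin_cases j <;>
      simp [inner_mul_left_S3 hp, inner_mul_left_S3' hp, real_inner_comm _ p, norm_S3 hp, qi_n, qj_n, qk_n,
        qi_r, qj_r, qk_r] <;> simp [inner_q, qi, qj, qk]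
  OrthonormalBasis.mk ho (by
    rw [ho.linearIndependent.span_eq_top_of_card_eq_finrank'
      (by rw [Quaternion.finrank_eq_four]; simp)])

lemma frame_sum (p : ℍ[ℝ]) (hp : p ∈ S3) (f : ℍ[ℝ] → ℝ) :
    ∑ i, f (frame p hp i) = f p + f (p * qi) + f (p * qj) + f (p * qk) := by
  simp [frame, Fin.sum_univ_four]

lemma parseval {p : ℍ[ℝ]} (hp : p ∈ S3) (v : ℍ[ℝ]) :
    ‖v‖^2 = ⟪v, p⟫^2 + ⟪v, p * qi⟫^2 + ⟪v, p * qj⟫^2 + ⟪v, p * qk⟫^2 := by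
  have h := (frame p hp).sum_sq_norm_inner_left v
  rw [← h]
  simp only [Real.norm_eq_abs, sq_abs]
  exact frame_sum p hp (fun w => ⟪v, w⟫^2)

lemma hs_indep {ι κ : Type*} [Fintype ι] [Fintype κ] (b : OrthonormalBasis ι ℝ ℍ[ℝ])
    (b' : OrthonormalBasis κ ℝ ℍ[ℝ]) (T : ℍ[ℝ] →ₗ[ℝ] ℍ[ℝ]) :
    ∑ i, ‖T (b i)‖^2 = ∑ i, ‖T (b' i)‖^2 := by
  have h : ∀ {μ : Type _} [Fintype μ] (c : OrthonormalBasis μ ℝ ℍ[ℝ]),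
      ∑ i, ‖T (c i)‖^2 = LinearMap.trace ℝ _ (LinearMap.adjoint T ∘ₗ T) := by
    intro μ _ c
    rw [LinearMap.trace_eq_sum_inner _ c]
    refine Finset.sum_congr rfl fun i _ => ?_
    simp [LinearMap.adjoint_inner_right]
  rw [h b]
  have h' : ∑ i, ‖T (b' i)‖^2 = LinearMap.trace ℝ _ (LinearMap.adjoint T ∘ₗ T) := by
    rw [LinearMap.trace_eq_sum_inner _ b']
    refine Finset.sum_congr rfl fun i _ => ?_
    simp [LinearMap.adjoint_inner_right]
  rw [h']

lemma tproj_add (p u v : ℍ[ℝ]) : tprojH p (u + v) = tprojH p u + tprojH p v := by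
  unfold tprojH; rw [inner_add_left, add_smul]; abel
lemma tproj_smul (p : ℍ[ℝ]) (r : ℝ) (u : ℍ[ℝ]) : tprojH p (r • u) = r • tprojH p u := by
  unfold tprojH; rw [real_inner_smul_left, smul_sub, smul_smul]

lemma tproj_tang {p u : ℍ[ℝ]} (hu : ⟪u, p⟫ = 0) : tprojH p u = u := by
  simp [tprojH, hu]

lemma tproj_self {p : ℍ[ℝ]} (hp : p ∈ S3) : tprojH p p = 0 := by
  simp [tprojH, norm_S3 hp]

lemma tproj_inner {p : ℍ[ℝ]} (hp : p ∈ S3) (u : ℍ[ℝ]) : ⟪tprojH p u, p⟫ = 0 := by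
  simp [tprojH, inner_sub_left, real_inner_smul_left, norm_S3 hp]

/-- projection as a linear map -/
noncomputable def tprojL (p : ℍ[ℝ]) : ℍ[ℝ] →ₗ[ℝ] ℍ[ℝ] where
  toFun := tprojH p
  map_add' := tproj_add p
  map_smul' := tproj_smul p

lemma norm_tproj {p : ℍ[ℝ]} (hp : p ∈ S3) (v : ℍ[ℝ]) :
    ‖tprojH p v‖^2 = ⟪v, p * qi⟫^2 + ⟪v, p * qj⟫^2 + ⟪v, p * qk⟫^2 := by
  have h := parseval hp v
  have h2 : ‖tprojH p v‖^2 = ‖v‖^2 - ⟪v, p⟫^2 := by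
    unfold tprojH
    rw [norm_sub_sq_real, real_inner_smul_right, norm_smul, norm_S3 hp, Real.norm_eq_abs, mul_one, sq_abs]
    ring
  rw [h2, h]; ring

lemma covNormSq_frame (X : ℍ[ℝ] → ℍ[ℝ]) {p : ℍ[ℝ]} (hp : p ∈ S3) :
    covNormSqH X p = ‖tprojH p (fderiv ℝ X p (p * qi))‖^2 + ‖tprojH p (fderiv ℝ X p (p * qj))‖^2
      + ‖tprojH p (fderiv ℝ X p (p * qk))‖^2 := by
  have h := hs_indep (stdOrthonormalBasis ℝ ℍ[ℝ]) (frame p hp)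
    ((tprojL p) ∘ₗ (fderiv ℝ X p).toLinearMap ∘ₗ (tprojL p))
  have h2 := frame_sum p hp (fun w => ‖((tprojL p) ∘ₗ (fderiv ℝ X p).toLinearMap ∘ₗ (tprojL p)) w‖^2)
  have h3 : covNormSqH X p = _ := h.trans h2
  rw [h3]
  have t : ∀ a, tprojL p a = tprojH p a := fun _ => rfl
  simp only [LinearMap.comp_apply, t, ContinuousLinearMap.coe_coe, tproj_self hp]
  rw [tproj_tang (u := p * qi) (by rw [inner_mul_left_S3' hp, qi_r]),
    tproj_tang (u := p * qj) (by rw [inner_mul_left_S3' hp, qj_r]),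
    tproj_tang (u := p * qk) (by rw [inner_mul_left_S3' hp, qk_r])]
  have z : tprojH p 0 = 0 := by simp [tprojH]
  simp [z]

/-- component of a field along `p * a` -/
noncomputable def comp (X : ℍ[ℝ] → ℍ[ℝ]) (a : ℍ[ℝ]) (p : ℍ[ℝ]) : ℝ := ⟪X p, p * a⟫

lemma comp_contDiff {X : ℍ[ℝ] → ℍ[ℝ]} (hX : ContDiff ℝ (⊤ : ℕ∞) X) (a : ℍ[ℝ]) :
    ContDiff ℝ (⊤ : ℕ∞) (comp X a) :=
  hX.inner ℝ (contDiff_id.mul contDiff_const)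

lemma D_comp {X : ℍ[ℝ] → ℍ[ℝ]} (hX : ContDiff ℝ (⊤ : ℕ∞) X) (a b p : ℍ[ℝ]) :
    ⟪fderiv ℝ X p (p * a), p * b⟫ = D a (comp X b) p - ⟪X p, p * (a * b)⟫ := by
  have h1 : HasFDerivAt X (fderiv ℝ X p) p :=
    (hX.differentiable (by simp)).differentiableAt.hasFDerivAt
  have h2 : HasFDerivAt (fun q : ℍ[ℝ] => q * b) ((ContinuousLinearMap.mul ℝ ℍ[ℝ]).flip b) p :=
    ((ContinuousLinearMap.mul ℝ ℍ[ℝ]).flip b).hasFDerivAt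
  have h3 := h1.inner ℝ h2
  have h4 : fderiv ℝ (comp X b) p = _ := h3.fderiv
  unfold D
  rw [h4]
  simp [fderivInnerCLM_apply, mul_assoc]

lemma lower_bound {X : ℍ[ℝ] → ℍ[ℝ]} (hX : ContDiff ℝ (⊤ : ℕ∞) X) (hT : IsTangentH X) :
    ∫ p, ‖X p‖ ^ 2 ∂smeasureH ≤ ∫ p, covNormSqH X p ∂smeasureH := by
  have h := bochner (comp_contDiff hX qi) (comp_contDiff hX qj) (comp_contDiff hX qk)
  convert h using 1
  · refine integral_congr_ae (ae_S3.mono fun p hp => ?_)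
    simp only
    rw [parseval hp, hT p hp]
    simp [comp]
  · refine integral_congr_ae (ae_S3.mono fun p hp => ?_)
    simp only
    rw [covNormSq_frame X hp, norm_tproj hp, norm_tproj hp, norm_tproj hp]
    simp only [D_comp hX, qii, qjj, qkk, qij, qji, qjk, qkj, qki, qik, mul_neg, mul_one,
      inner_neg_right, hT p hp]
    simp only [comp]
    ring

lemma leftInv_eq {X : ℍ[ℝ] → ℍ[ℝ]} (hL : IsLeftInvariantH X) {q : ℍ[ℝ]} (hq : q ∈ S3) :
    X q = q * X 1 := by
  simpa using hL q hq 1 one_S3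

lemma leftInv_re {X : ℍ[ℝ] → ℍ[ℝ]} (hT : IsTangentH X) : (X 1).re = 0 := by
  simpa [inner_q] using hT 1 one_S3

lemma leftInv_fderiv {X : ℍ[ℝ] → ℍ[ℝ]} (hX : ContDiff ℝ (⊤ : ℕ∞) X)
    (hL : IsLeftInvariantH X) {p u : ℍ[ℝ]} (hp : p ∈ S3) (hu : ⟪u, p⟫ = 0) :
    fderiv ℝ X p u = u * X 1 := by
  have h2 : HasFDerivAt (fun q : ℍ[ℝ] => q * X 1) ((ContinuousLinearMap.mul ℝ ℍ[ℝ]).flip (X 1)) p :=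
    ((ContinuousLinearMap.mul ℝ ℍ[ℝ]).flip (X 1)).hasFDerivAt
  rw [fderiv_tang hp hu (hX.differentiable (by simp)).differentiableAt h2.differentiableAt
    (fun q hq => leftInv_eq hL hq), h2.fderiv]
  simp

lemma leftInv_energy {X : ℍ[ℝ] → ℍ[ℝ]} (hX : ContDiff ℝ (⊤ : ℕ∞) X) (hT : IsTangentH X)
    (hL : IsLeftInvariantH X) (h0 : ∃ p ∈ S3, X p ≠ 0) : energyH X = 2 := by
  obtain ⟨p, hp, hne⟩ := h0
  have hpos : 0 < ∫ p, ‖X p‖^2 ∂smeasureH :=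
    integral_pos_S3 (hX.continuous.norm.pow 2) (fun _ => by positivity) hp (by simpa using hne)
  have e : ∫ p, covNormSqH X p ∂smeasureH = ∫ p, 2 * ‖X p‖^2 ∂smeasureH := by
    refine integral_congr_ae (ae_S3.mono fun p hp => ?_)
    simp only
    rw [covNormSq_frame X hp, norm_tproj hp, norm_tproj hp, norm_tproj hp,
      leftInv_fderiv hX hL hp (by rw [inner_mul_left_S3' hp, qi_r]),
      leftInv_fderiv hX hL hp (by rw [inner_mul_left_S3' hp, qj_r]),
      leftInv_fderiv hX hL hp (by rw [inner_mul_left_S3' hp, qk_r]), leftInv_eq hL hp, norm_mul,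
      norm_S3 hp, one_mul, norm_sq_q, leftInv_re hT]
    simp only [mul_assoc, inner_mul_left_S3 hp]
    simp [inner_q, qi, qj, qk, leftInv_re hT]
    ring
  unfold energyH
  rw [e, integral_const_mul]
  field_simp

lemma leftInv_cov {X : ℍ[ℝ] → ℍ[ℝ]} (hX : ContDiff ℝ (⊤ : ℕ∞) X) (hT : IsTangentH X)
    (hL : IsLeftInvariantH X) (e : ℍ[ℝ]) {q : ℍ[ℝ]} (hq : q ∈ S3) :
    covDH X q e = e * X 1 - ⟪e, q⟫ • (q * X 1) - ⟪e * X 1, q⟫ • q := by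
  unfold covDH
  rw [leftInv_fderiv hX hL hq (tproj_inner hq e)]
  unfold tprojH
  rw [sub_mul, inner_sub_left, smul_mul_assoc, real_inner_smul_left, inner_mul_left_S3' hq,
    leftInv_re hT]
  simp

lemma leftInv_lap {X : ℍ[ℝ] → ℍ[ℝ]} (hX : ContDiff ℝ (⊤ : ℕ∞) X) (hT : IsTangentH X)
    (hL : IsLeftInvariantH X) {p : ℍ[ℝ]} (hp : p ∈ S3) :
    -(roughLapH X p) = (2:ℝ) • X p := by
  have hre := leftInv_re hT
  have hpa : ⟪p * X 1, p⟫ = 0 := by rw [inner_mul_left_S3' hp, hre]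
  set b := stdOrthonormalBasis ℝ ℍ[ℝ] with hb
  have term : ∀ e : ℍ[ℝ], ‖e‖ = 1 →
      tprojH p (fderiv ℝ (fun q => covDH X q e) p (tprojH p e))
      = (⟪e, p⟫^2 - 1) • (p * X 1) - ⟪e, p⟫ • tprojH p (tprojH p e * X 1)
        + ⟪e, p * X 1⟫ • tprojH p e := by
    intro e he
    have hFd : DifferentiableAt ℝ (fun q => covDH X q e) p := by
      have h1 : ContDiff ℝ (⊤ : ℕ∞) (fun q => tprojH q e) := by
        unfold tprojH
        exact contDiff_const.sub ((contDiff_const.inner ℝ contDiff_id).smul contDiff_id)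
      have h2 : ContDiff ℝ (⊤ : ℕ∞) (fun q => fderiv ℝ X q (tprojH q e)) :=
        (hX.fderiv_right (m := (⊤ : ℕ∞)) (by simp)).clm_apply h1
      have h3 : ContDiff ℝ (⊤ : ℕ∞) (fun q => covDH X q e) := by
        unfold covDH
        change ContDiff ℝ (⊤ : ℕ∞) (fun q => fderiv ℝ X q (tprojH q e)
          - ⟪fderiv ℝ X q (tprojH q e), q⟫ • q)
        exact h2.sub ((h2.inner ℝ contDiff_id).smul contDiff_id)
      exact (h3.differentiable (by simp)).differentiableAt
    have hR : HasFDerivAt (fun q : ℍ[ℝ] => q * X 1) ((ContinuousLinearMap.mul ℝ ℍ[ℝ]).flip (X 1)) p :=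
      ((ContinuousLinearMap.mul ℝ ℍ[ℝ]).flip (X 1)).hasFDerivAt
    have hi : ∀ w : ℍ[ℝ], HasFDerivAt (fun q : ℍ[ℝ] => ⟪w, q⟫) (innerSL ℝ w) p :=
      fun w => (innerSL ℝ w).hasFDerivAt
    have hG := ((hasFDerivAt_const (e * X 1) p).sub ((hi e).smul hR)).sub
      ((hi (e * X 1)).smul (hasFDerivAt_id p))
    have key := fderiv_tang hp (tproj_inner hp e) hFd hG.differentiableAt
      (fun q hq => by simpa using leftInv_cov hX hT hL e hq)
    rw [key, hG.fderiv]
    have hu := tproj_inner hp e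
    have heu : ⟪e, tprojH p e⟫ = 1 - ⟪e, p⟫^2 := by
      simp [tprojH, inner_sub_right, real_inner_smul_right, he]; ring
    have hea : ⟪e * X 1, p⟫ = -⟪e, p * X 1⟫ := by
      simp [inner_q, hre]; ring
    set u := tprojH p e
    have hval : tprojH p (-(⟪e, p⟫ • (u * X 1) + ⟪e, u⟫ • (p * X 1))
        - (⟪e * X 1, p⟫ • u + ⟪e * X 1, u⟫ • p))
       = (⟪e, p⟫^2 - 1) • (p * X 1) - ⟪e, p⟫ • tprojH p (u * X 1) + ⟪e, p * X 1⟫ • u := by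
      rw [heu, hea]
      have t : ∀ a, tprojH p a = tprojL p a := fun _ => rfl
      rw [t, t, map_sub, map_neg, map_add, map_add, map_smul, map_smul, map_smul, map_smul,
        ← t, ← t, ← t, ← t, tproj_tang hpa, tproj_tang hu, tproj_self hp]
      module
    rw [← hval]
    congr 1
    simp
  have hsum : roughLapH X p = ∑ i, ((⟪b i, p⟫^2 - 1) • (p * X 1)
      - ⟪b i, p⟫ • tprojH p (tprojH p (b i) * X 1) + ⟪b i, p * X 1⟫ • tprojH p (b i)) := by
    unfold roughLapH
    exact Finset.sum_congr rfl fun i _ => term (b i) (b.norm_eq_one i)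
  have s1 : ∑ i, (⟪b i, p⟫^2 - 1) = -3 := by
    have h1 := b.sum_sq_norm_inner_right p
    simp only [Real.norm_eq_abs, sq_abs, norm_S3 hp] at h1
    rw [Finset.sum_sub_distrib, h1]
    simp [Quaternion.finrank_eq_four]; norm_num
  let T : ℍ[ℝ] →ₗ[ℝ] ℍ[ℝ] := (tprojL p) ∘ₗ (LinearMap.mulRight ℝ (X 1)) ∘ₗ (tprojL p)
  have s2 : ∑ i, ⟪b i, p⟫ • tprojH p (tprojH p (b i) * X 1) = 0 := by
    have h1 : ∑ i, ⟪b i, p⟫ • T (b i) = T p := by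
      conv_rhs => rw [← b.sum_repr' p]
      simp only [map_sum, map_smul]
    have h2 : T p = 0 := by
      change tprojH p (tprojH p p * X 1) = 0
      rw [tproj_self hp]; simp [tprojH]
    exact h1.trans h2
  have s3 : ∑ i, ⟪b i, p * X 1⟫ • tprojH p (b i) = p * X 1 := by
    have h1 : ∑ i, ⟪b i, p * X 1⟫ • tprojL p (b i) = tprojL p (p * X 1) := by
      conv_rhs => rw [← b.sum_repr' (p * X 1)]
      simp only [map_sum, map_smul]
    exact h1.trans (tproj_tang hpa)
  rw [hsum, Finset.sum_add_distrib, Finset.sum_sub_distrib, ← Finset.sum_smul, s1, s2, s3,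
    leftInv_eq hL hp]
  module

/-- the minimizing field: gradient of a linear function -/
lemma min_field : ∃ X : ℍ[ℝ] → ℍ[ℝ],
        ContDiff ℝ (⊤ : ℕ∞) X ∧ IsTangentH X ∧ (∃ p ∈ S3, X p ≠ 0) ∧ energyH X = 1 := by
  have hcd : ContDiff ℝ (⊤ : ℕ∞) (fun p => tprojH p 1) := by
    unfold tprojH
    exact contDiff_const.sub ((contDiff_const.inner ℝ contDiff_id).smul contDiff_id)
  have hqi : qi ∈ S3 := by simpa [S3] using qi_n
  have hqj : qj ∈ S3 := by simpa [S3] using qj_n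
  have hqk : qk ∈ S3 := by simpa [S3] using qk_n
  have hne : tprojH qi 1 ≠ 0 := by
    intro h
    have := congrArg (fun q : ℍ[ℝ] => q.re) h
    simp [tprojH, qi] at this
  refine ⟨fun p => tprojH p 1, hcd, fun p hp => tproj_inner hp 1, ⟨qi, hqi, hne⟩, ?_⟩
  have hpos : 0 < ∫ p, ‖tprojH p 1‖^2 ∂smeasureH :=
    integral_pos_S3 (hcd.continuous.norm.pow 2) (fun _ => by positivity) hqi (by simpa using hne)
  unfold energyH
  rw [div_eq_one_iff_eq hpos.ne']
  have c0 := cd_re.continuous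
  have c1 := cd_imI.continuous
  have c2 := cd_imJ.continuous
  have c3 := cd_imK.continuous
  have e1 : ∫ p, covNormSqH (fun p => tprojH p 1) p ∂smeasureH
      = ∫ p : ℍ[ℝ], 3 * p.re^2 ∂smeasureH := by
    refine integral_congr_ae (ae_S3.mono fun p hp => ?_)
    simp only
    have hi : HasFDerivAt (fun q : ℍ[ℝ] => ⟪(1:ℍ[ℝ]), q⟫) (innerSL ℝ (1:ℍ[ℝ])) p :=
      (innerSL ℝ (1:ℍ[ℝ])).hasFDerivAt
    have hG := (hasFDerivAt_const (1 : ℍ[ℝ]) p).sub (hi.smul (hasFDerivAt_id p))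
    have hG' : fderiv ℝ (fun p => tprojH p 1) p = _ := hG.fderiv
    have hval : ∀ u : ℍ[ℝ], ⟪u, p⟫ = 0 →
        ‖tprojH p (fderiv ℝ (fun p => tprojH p 1) p u)‖^2 = p.re^2 * ‖u‖^2 := by
      intro u hu
      have h1 : fderiv ℝ (fun p => tprojH p 1) p u = (-p.re) • u + (-u.re) • p := by
        rw [hG']
        simp [inner_q, add_comm]
      rw [h1, tproj_add, tproj_smul, tproj_smul, tproj_tang hu, tproj_self hp]
      simp [norm_smul, mul_pow]
    rw [covNormSq_frame _ hp, hval _ (by rw [inner_mul_left_S3' hp, qi_r]),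
      hval _ (by rw [inner_mul_left_S3' hp, qj_r]), hval _ (by rw [inner_mul_left_S3' hp, qk_r])]
    simp only [norm_mul, norm_S3 hp, qi_n, qj_n, qk_n]
    ring
  have e2 : ∫ p, ‖tprojH p 1‖^2 ∂smeasureH
      = ∫ p : ℍ[ℝ], (p.imI^2 + p.imJ^2 + p.imK^2) ∂smeasureH := by
    refine integral_congr_ae (ae_S3.mono fun p hp => ?_)
    simp only
    rw [norm_tproj hp]
    simp [inner_q, qi, qj, qk]
  have r1 := integral_right hqi (f := fun p : ℍ[ℝ] => p.re^2) (by fun_prop)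
  have r2 := integral_right hqj (f := fun p : ℍ[ℝ] => p.re^2) (by fun_prop)
  have r3 := integral_right hqk (f := fun p : ℍ[ℝ] => p.re^2) (by fun_prop)
  simp [qi, qj, qk] at r1 r2 r3
  rw [e1, e2, integral_const_mul, integral_add, integral_add, r1, r2, r3]
  · ring
  all_goals exact cont_integrable (by fun_prop)

/-- **Remark `by`.** On the unit sphere `S³` with its bi-invariant metric:
the `S³`-invariant vector fields are exactly the left invariant ones; every
`S³`-invariant (smooth, tangent) vector field is an eigenvector field of the rough
Laplacian `−div∇`; every nonzero left invariant vector field `X` has energy `F(X) = 2`;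
and nevertheless the infimum of the energy functional `F` over all nonzero smooth
vector fields of `S³` is `1` — so the `S³`-invariant fields do not realize the infimum
of the energy. -/
theorem s3_invariant_fields_do_not_minimize_energy :
    (∀ X : Quaternion ℝ → Quaternion ℝ, ContDiff ℝ (⊤ : ℕ∞) X → IsTangentH X →
        (IsS3Invariant X ↔ IsLeftInvariantH X)) ∧
    (∀ X : Quaternion ℝ → Quaternion ℝ, ContDiff ℝ (⊤ : ℕ∞) X → IsTangentH X →
        IsS3Invariant X → (∃ p ∈ S3, X p ≠ 0) →
        ∃ lam : ℝ, ∀ p ∈ S3, -(roughLapH X p) = lam • X p) ∧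
    (∀ X : Quaternion ℝ → Quaternion ℝ, ContDiff ℝ (⊤ : ℕ∞) X → IsTangentH X →
        IsLeftInvariantH X → (∃ p ∈ S3, X p ≠ 0) → energyH X = 2) ∧
    IsGLB {r : ℝ | ∃ X : Quaternion ℝ → Quaternion ℝ,
        ContDiff ℝ (⊤ : ℕ∞) X ∧ IsTangentH X ∧ (∃ p ∈ S3, X p ≠ 0) ∧ energyH X = r} 1 := by
  have hiff : ∀ X : ℍ[ℝ] → ℍ[ℝ], IsS3Invariant X ↔ IsLeftInvariantH X := by
    intro X
    have h : ∀ g p v : ℍ[ℝ], fderiv ℝ (fun q : ℍ[ℝ] => g * q) p v = g * v := by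
      intro g p v
      have h2 : HasFDerivAt (fun q : ℍ[ℝ] => g * q) (ContinuousLinearMap.mul ℝ ℍ[ℝ] g) p :=
        (ContinuousLinearMap.mul ℝ ℍ[ℝ] g).hasFDerivAt
      rw [h2.fderiv]
      simp
    simp only [IsS3Invariant, IsLeftInvariantH, h]
  refine ⟨fun X _ _ => hiff X, fun X hX hT hI _ => ⟨2, fun p hp => ?_⟩,
    fun X hX hT hL h0 => leftInv_energy hX hT hL h0, ?_, fun r hr => hr min_field⟩
  · exact leftInv_lap hX hT ((hiff X).1 hI) hp
  · rintro r ⟨X, hX, hT, ⟨p, hp, hne⟩, rfl⟩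
    have hpos : 0 < ∫ p, ‖X p‖^2 ∂smeasureH :=
      integral_pos_S3 (hX.continuous.norm.pow 2) (fun _ => by positivity) hp (by simpa using hne)
    unfold energyH
    rw [one_le_div hpos]
    exact lower_bound hX hT
end

section
/- The infimum of the energy functional F(X) = ∫ ‖∇X‖² / ∫ ‖X‖² over all nonzero smooth vector fields X on the sphere S^n(1/k) of radius 1/k in ℝ^{n+1}, n ≥ 2, equals k², and it is attained by the vector field given by the pointwise orthogonal projection onto the tangent spaces of S^n(1/k) of a constant nonzero vector field of ℝ^{n+1}. Moreover, a Killing field of S^n(1/k) realizes this infimum k² if and only if n = 2. -/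
open MeasureTheory Metric
open scoped RealInnerProductSpace

noncomputable section

/-- The sphere of radius `1/k` centered at the origin of `ℝ^{n+1}`. -/
def Sph (n : ℕ) (k : ℝ) : Set (EuclideanSpace ℝ (Fin (n + 1))) :=
  sphere (0 : EuclideanSpace ℝ (Fin (n + 1))) (1 / k)

/-- Orthogonal projection onto the tangent space of `S^n(1/k)` at `p` (for `p` on the
sphere, i.e. `‖p‖ = 1/k`): `u ↦ u − k²⟨u,p⟩p`. -/
def tproj (n : ℕ) (k : ℝ) (p u : EuclideanSpace ℝ (Fin (n + 1))) :
    EuclideanSpace ℝ (Fin (n + 1)) :=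
  u - (k ^ 2 * ⟪u, p⟫) • p

/-- Covariant derivative (Levi–Civita connection of `S^n(1/k)`) of the vector field `X`
at `p` in the (tangential part of the) direction `u`: the tangential projection of the
ambient directional derivative. -/
def covD (n : ℕ) (k : ℝ) (X : EuclideanSpace ℝ (Fin (n + 1)) → EuclideanSpace ℝ (Fin (n + 1)))
    (p u : EuclideanSpace ℝ (Fin (n + 1))) : EuclideanSpace ℝ (Fin (n + 1)) :=
  tproj n k p (fderiv ℝ X p (tproj n k p u))

/-- Pointwise squared norm `‖∇X‖²` of the covariant derivative of `X` at `p` (the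
Hilbert–Schmidt norm; summing over the standard orthonormal basis of the ambient space
is the same as summing over an orthonormal basis of the tangent space, since the
normal direction is projected away). -/
def covNormSq (n : ℕ) (k : ℝ)
    (X : EuclideanSpace ℝ (Fin (n + 1)) → EuclideanSpace ℝ (Fin (n + 1)))
    (p : EuclideanSpace ℝ (Fin (n + 1))) : ℝ :=
  ∑ i : Fin (n + 1), ‖covD n k X p (EuclideanSpace.single i 1)‖ ^ 2

/-- The Riemannian volume measure of `S^n(1/k)`: the `n`-dimensional Hausdorff measure
restricted to the sphere. -/
def smeasure (n : ℕ) (k : ℝ) : Measure (EuclideanSpace ℝ (Fin (n + 1))) :=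
  (μH[(n : ℝ)]).restrict (Sph n k)

/-- The energy functional `F(X) = (∫ ‖∇X‖²)/(∫ ‖X‖²)` on vector fields of `S^n(1/k)`. -/
def energy (n : ℕ) (k : ℝ)
    (X : EuclideanSpace ℝ (Fin (n + 1)) → EuclideanSpace ℝ (Fin (n + 1))) : ℝ :=
  (∫ p, covNormSq n k X p ∂smeasure n k) / (∫ p, ‖X p‖ ^ 2 ∂smeasure n k)

/-- A vector field (given by an ambient extension) is tangent to `S^n(1/k)`. -/
def IsTangent (n : ℕ) (k : ℝ)
    (X : EuclideanSpace ℝ (Fin (n + 1)) → EuclideanSpace ℝ (Fin (n + 1))) : Prop :=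
  ∀ p ∈ Sph n k, ⟪X p, p⟫ = 0

/-- `X` is a Killing field of `S^n(1/k)`: its Killing tensor
`Kill(X)(u,v) = (⟨∇ᵤX, v⟩ + ⟨∇ᵥX, u⟩)/2` vanishes identically (equivalently, its flow
consists of isometries). -/
def IsKillingField (n : ℕ) (k : ℝ)
    (X : EuclideanSpace ℝ (Fin (n + 1)) → EuclideanSpace ℝ (Fin (n + 1))) : Prop :=
  ∀ p ∈ Sph n k, ∀ u v : EuclideanSpace ℝ (Fin (n + 1)),
    ⟪u, p⟫ = 0 → ⟪v, p⟫ = 0 → ⟪covD n k X p u, v⟫ + ⟪covD n k X p v, u⟫ = 0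

end


section Helpers

open Set

/-- chart by radial projection of a face of the cube -/
noncomputable def faceZ (n : ℕ) (i : Fin (n + 1)) (s : ℝ) (y : Fin n → ℝ) :
    EuclideanSpace ℝ (Fin (n + 1)) :=
  WithLp.toLp 2 (i.insertNth (α := fun _ => ℝ) s y)

noncomputable def faceG (n : ℕ) (k : ℝ) (i : Fin (n + 1)) (s : ℝ) (y : Fin n → ℝ) :
    EuclideanSpace ℝ (Fin (n + 1)) :=
  (k * ‖faceZ n i s y‖)⁻¹ • faceZ n i s y

lemma faceZ_contDiff (n : ℕ) (i : Fin (n + 1)) (s : ℝ) : ContDiff ℝ 1 (faceZ n i s) := by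
  rw [contDiff_euclidean]
  intro j
  refine Fin.succAboveCases i ?_ (fun l => ?_) j
  · simp only [faceZ, Fin.insertNth_apply_same]
    exact contDiff_const
  · simp only [faceZ, Fin.insertNth_apply_succAbove]
    fun_prop

lemma faceZ_ne (n : ℕ) (i : Fin (n + 1)) (s : ℝ) (hs : s ≠ 0) (y : Fin n → ℝ) :
    faceZ n i s y ≠ 0 := by
  intro h
  have := congrArg (fun z : EuclideanSpace ℝ (Fin (n + 1)) => z i) h
  simp [faceZ] at this
  exact hs this

lemma faceG_contDiff (n : ℕ) (k : ℝ) (hk : 0 < k) (i : Fin (n + 1)) (s : ℝ) (hs : s ≠ 0) :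
    ContDiff ℝ 1 (faceG n k i s) := by
  unfold faceG
  refine ContDiff.smul (ContDiff.inv (𝕜' := ℝ) (contDiff_const.mul ?_) ?_) (faceZ_contDiff n i s)
  · exact (faceZ_contDiff n i s).norm ℝ (faceZ_ne n i s hs)
  · intro y
    have := norm_pos_iff.2 (faceZ_ne n i s hs y)
    positivity

lemma haus_pi (n : ℕ) : (μH[(n : ℝ)] : Measure (Fin n → ℝ)) = volume := by
  have := hausdorffMeasure_pi_real (ι := Fin n)
  simpa using this

lemma faceG_finite (n : ℕ) (k : ℝ) (hk : 0 < k) (i : Fin (n + 1)) (s : ℝ) (hs : s ≠ 0) :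
    μH[(n : ℝ)] (faceG n k i s '' Icc (-1) 1) < ⊤ := by
  obtain ⟨K, hK⟩ := (faceG_contDiff n k hk i s hs).contDiffOn.exists_lipschitzOnWith
    one_ne_zero (convex_Icc (-1 : Fin n → ℝ) 1) isCompact_Icc
  refine (hK.hausdorffMeasure_image_le (Nat.cast_nonneg n)).trans_lt ?_
  rw [haus_pi]
  refine ENNReal.mul_lt_top ?_ isCompact_Icc.measure_lt_top
  simp

lemma sph_subset (n : ℕ) (k : ℝ) (hk : 0 < k) :
    Sph n k ⊆ ⋃ i : Fin (n + 1), (faceG n k i 1 '' Icc (-1) 1 ∪ faceG n k i (-1) '' Icc (-1) 1) := by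
  intro p hp
  have hp' : ‖p‖ = 1 / k := by simpa [Sph] using hp
  obtain ⟨i, -, hi⟩ := Finset.exists_max_image (Finset.univ : Finset (Fin (n + 1)))
    (fun i => |p i|) ⟨0, Finset.mem_univ _⟩
  have hpos : 0 < |p i| := by
    rcases (abs_nonneg (p i)).lt_or_eq with h | h
    · exact h
    · exfalso
      have : p = 0 := by
        ext j
        have := hi j (Finset.mem_univ _)
        rw [← h] at this
        simpa using this
      rw [this] at hp'
      simp at hp'
      exact hk.ne' hp'.symm
  have key : ∀ s : ℝ, p i = s * |p i| → p ∈ faceG n k i s '' Icc (-1) 1 := by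
    intro s hs
    refine ⟨fun j => p (i.succAbove j) / |p i|, ?_, ?_⟩
    · refine ⟨fun j => ?_, fun j => ?_⟩
      · have := hi (i.succAbove j) (Finset.mem_univ _)
        simp only [Pi.neg_apply, Pi.one_apply]
        rw [le_div_iff₀ hpos]
        linarith [neg_abs_le (p (i.succAbove j))]
      · have := hi (i.succAbove j) (Finset.mem_univ _)
        simp only [Pi.one_apply]
        rw [div_le_iff₀ hpos]
        linarith [le_abs_self (p (i.succAbove j))]
    · have hz : faceZ n i s (fun j => p (i.succAbove j) / |p i|) = (|p i|)⁻¹ • p := by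
        ext j
        refine Fin.succAboveCases i ?_ (fun l => ?_) j
        · simp only [faceZ, Fin.insertNth_apply_same, PiLp.smul_apply, smul_eq_mul]
          rw [eq_inv_mul_iff_mul_eq₀ hpos.ne', mul_comm]
          exact hs.symm
        · simp only [faceZ, Fin.insertNth_apply_succAbove, PiLp.smul_apply, smul_eq_mul]
          rw [div_eq_inv_mul]
      rw [faceG, hz, norm_smul, hp', smul_smul]
      have : (k * (‖(|p i|)⁻¹‖ * (1 / k)))⁻¹ * (|p i|)⁻¹ = 1 := by
        rw [Real.norm_eq_abs, abs_inv, abs_abs]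
        field_simp
      rw [this, one_smul]
  rw [mem_iUnion]
  refine ⟨i, ?_⟩
  rcases le_total 0 (p i) with h | h
  · left; apply key; rw [abs_of_nonneg h, one_mul]
  · right; apply key; rw [abs_of_nonpos h]; ring

lemma sph_finite (n : ℕ) (k : ℝ) (hk : 0 < k) : μH[(n : ℝ)] (Sph n k) < ⊤ := by
  refine (measure_mono (sph_subset n k hk)).trans_lt ?_
  refine (measure_iUnion_fintype_le _ _).trans_lt ?_
  rw [ENNReal.sum_lt_top]
  intro i _
  exact measure_union_lt_top (faceG_finite n k hk i 1 one_ne_zero)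
    (faceG_finite n k hk i (-1) (by norm_num))

lemma sph_pos (n : ℕ) (k : ℝ) (hk : 0 < k) : 0 < μH[(n : ℝ)] (Sph n k) := by
  let π : EuclideanSpace ℝ (Fin (n + 1)) → (Fin n → ℝ) := fun p j => p j.succ
  have hπ : LipschitzWith 1 π := by
    refine LipschitzWith.of_dist_le_mul fun p q => ?_
    rw [NNReal.coe_one, one_mul, dist_pi_le_iff dist_nonneg]
    intro j
    have := PiLp.norm_apply_le (p - q) j.succ
    simpa [dist_eq_norm] using this
  have h1 := hπ.hausdorffMeasure_image_le (d := n) (Nat.cast_nonneg n) (Sph n k)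
  rw [haus_pi] at h1
  have hU : IsOpen {y : Fin n → ℝ | ∑ j, y j ^ 2 < 1 / k ^ 2} :=
    isOpen_lt (by fun_prop) continuous_const
  have hne : {y : Fin n → ℝ | ∑ j, y j ^ 2 < 1 / k ^ 2}.Nonempty := by
    refine ⟨0, ?_⟩
    simp
    positivity
  have hsub : {y : Fin n → ℝ | ∑ j, y j ^ 2 < 1 / k ^ 2} ⊆ π '' Sph n k := by
    intro y hy
    rw [mem_ofPred_eq] at hy
    refine ⟨WithLp.toLp 2 (Fin.cons (Real.sqrt (1 / k ^ 2 - ∑ j, y j ^ 2)) y), ?_, ?_⟩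
    · simp only [Sph, mem_sphere_iff_norm, sub_zero]
      rw [EuclideanSpace.norm_eq, Fin.sum_univ_succ]
      simp only [Fin.cons_zero, Fin.cons_succ, Real.norm_eq_abs, sq_abs]
      rw [Real.sq_sqrt (by linarith), sub_add_cancel, Real.sqrt_eq_iff_mul_self_eq (by positivity) (by positivity)]
      field_simp
    · ext j
      simp [π]
  have h2 := (hU.measure_pos volume hne).trans_le ((measure_mono hsub).trans h1)
  simpa using h2

lemma sph_compact (n : ℕ) (k : ℝ) : IsCompact (Sph n k) := isCompact_sphere _ _

lemma sph_meas (n : ℕ) (k : ℝ) : MeasurableSet (Sph n k) := (sph_compact n k).measurableSet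

lemma smeasure_fin (n : ℕ) (k : ℝ) (hk : 0 < k) : IsFiniteMeasure (smeasure n k) :=
  ⟨by simpa [smeasure] using sph_finite n k hk⟩

lemma ae_mem_sph (n : ℕ) (k : ℝ) : ∀ᵐ p ∂smeasure n k, p ∈ Sph n k :=
  ae_restrict_mem (sph_meas n k)

lemma cont_integrable_s5 {n : ℕ} {k : ℝ} (hk : 0 < k) {f : EuclideanSpace ℝ (Fin (n + 1)) → ℝ}
    (hf : Continuous f) : Integrable f (smeasure n k) := by
  have := smeasure_fin n k hk
  obtain ⟨C, hC⟩ := (sph_compact n k).exists_bound_of_continuousOn hf.continuousOn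
  refine Integrable.of_bound hf.aestronglyMeasurable C ?_
  filter_upwards [ae_mem_sph n k] with p hp using hC p hp

lemma smeasure_mp (n : ℕ) (k : ℝ)
    (e : EuclideanSpace ℝ (Fin (n + 1)) ≃ₗᵢ[ℝ] EuclideanSpace ℝ (Fin (n + 1))) :
    MeasurePreserving e (smeasure n k) (smeasure n k) := by
  have h := (e.toIsometryEquiv.measurePreserving_hausdorffMeasure (n : ℝ)).restrict_preimage
    (sph_meas n k)
  have h2 : e.toIsometryEquiv ⁻¹' Sph n k = Sph n k := by
    ext p
    simp [Sph]
  rw [h2] at h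
  exact h

lemma smeasure_integral_comp (n : ℕ) (k : ℝ)
    (e : EuclideanSpace ℝ (Fin (n + 1)) ≃ₗᵢ[ℝ] EuclideanSpace ℝ (Fin (n + 1)))
    (f : EuclideanSpace ℝ (Fin (n + 1)) → ℝ) :
    ∫ p, f (e p) ∂smeasure n k = ∫ p, f p ∂smeasure n k :=
  (smeasure_mp n k e).integral_comp e.toHomeomorph.measurableEmbedding f

lemma smeasure_ball_pos (n : ℕ) (k : ℝ) (hk : 0 < k) (p : EuclideanSpace ℝ (Fin (n + 1)))
    (hp : p ∈ Sph n k) (r : ℝ) (hr : 0 < r) : 0 < smeasure n k (ball p r) := by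
  rw [pos_iff_ne_zero]
  intro h0
  have hall : ∀ q ∈ Sph n k, smeasure n k (ball q r) = 0 := by
    intro q hq
    have hpq : ‖q‖ = ‖p‖ := by
      have h1 : ‖p‖ = 1 / k := by simpa [Sph] using hp
      have h2 : ‖q‖ = 1 / k := by simpa [Sph] using hq
      rw [h1, h2]
    let e := (Submodule.reflection (Submodule.span ℝ {q - p})ᗮ)
    have he : e q = p := Submodule.reflection_sub hpq
    have h3 := (smeasure_mp n k e).measure_preimage (s := ball p r)
      measurableSet_ball.nullMeasurableSet
    rw [h0] at h3
    have : e ⁻¹' ball p r = ball q r := by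
      rw [← he]
      ext x
      simp
    rwa [this] at h3
  have hS : smeasure n k (Sph n k) = 0 := by
    refine (sph_compact n k).measure_zero_of_nhdsWithin fun q hq => ?_
    exact ⟨ball q r, mem_nhdsWithin_of_mem_nhds (ball_mem_nhds q hr), hall q hq⟩
  have := sph_pos n k hk
  simp [smeasure] at hS
  exact this.ne' hS

lemma integral_normSq_pos (n : ℕ) (k : ℝ) (hk : 0 < k)
    (X : EuclideanSpace ℝ (Fin (n + 1)) → EuclideanSpace ℝ (Fin (n + 1)))
    (hX : Continuous X) (h : ∃ p ∈ Sph n k, X p ≠ 0) :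
    0 < ∫ p, ‖X p‖ ^ 2 ∂smeasure n k := by
  obtain ⟨p, hp, hXp⟩ := h
  rw [integral_pos_iff_support_of_nonneg (fun p => by positivity) (cont_integrable_s5 hk (by fun_prop))]
  have ho : IsOpen {q | X q ≠ 0} := isOpen_ne_fun hX continuous_const
  obtain ⟨r, hr, hsub⟩ := Metric.isOpen_iff.1 ho p hXp
  refine (smeasure_ball_pos n k hk p hp r hr).trans_le (measure_mono fun q hq => ?_)
  have := hsub hq
  simpa using this

/-- the one-parameter group generated by a skew operator -/
lemma exp_skew {n : ℕ} (A : EuclideanSpace ℝ (Fin (n + 1)) →L[ℝ] EuclideanSpace ℝ (Fin (n + 1)))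
    (hA : ∀ x y, ⟪A x, y⟫ = -⟪x, A y⟫) (t : ℝ) :
    ∃ e : EuclideanSpace ℝ (Fin (n + 1)) ≃ₗᵢ[ℝ] EuclideanSpace ℝ (Fin (n + 1)),
      ∀ p, e p = NormedSpace.exp (t • A) p := by
  have hmem : t • A ∈ skewAdjoint
      (EuclideanSpace ℝ (Fin (n + 1)) →L[ℝ] EuclideanSpace ℝ (Fin (n + 1))) := by
    rw [skewAdjoint.mem_iff, ContinuousLinearMap.star_eq_adjoint, eq_comm,
      ContinuousLinearMap.eq_adjoint_iff]
    intro x y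
    simp [inner_smul_left, inner_smul_right, hA]
  let _ : NormedAlgebra ℚ (EuclideanSpace ℝ (Fin (n + 1)) →L[ℝ] EuclideanSpace ℝ (Fin (n + 1))) :=
    .restrictScalars ℚ ℝ _
  exact ⟨Unitary.linearIsometryEquiv ⟨_, NormedSpace.exp_mem_unitary_of_mem_skewAdjoint hmem⟩,
    fun p => rfl⟩

lemma exp_hasDeriv {n : ℕ}
    (A : EuclideanSpace ℝ (Fin (n + 1)) →L[ℝ] EuclideanSpace ℝ (Fin (n + 1))) (t : ℝ)
    (p : EuclideanSpace ℝ (Fin (n + 1))) :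
    HasDerivAt (fun t : ℝ => NormedSpace.exp (t • A) p) (A (NormedSpace.exp (t • A) p)) t := by
  have h := hasDerivAt_exp_smul_const' (𝕂 := ℝ) A t
  exact h.clm_apply (hasDerivAt_const t p) |>.congr_deriv (by simp)

lemma exp_zero_apply {n : ℕ}
    (A : EuclideanSpace ℝ (Fin (n + 1)) →L[ℝ] EuclideanSpace ℝ (Fin (n + 1)))
    (p : EuclideanSpace ℝ (Fin (n + 1))) : NormedSpace.exp ((0 : ℝ) • A) p = p := by
  have h : (0 : ℝ) • A = 0 := by ext x; simp
  rw [h, NormedSpace.exp_zero]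
  rfl

/-- infinitesimal rotation invariance -/
lemma integral_skew {n : ℕ} {k : ℝ} (hk : 0 < k)
    (A : EuclideanSpace ℝ (Fin (n + 1)) →L[ℝ] EuclideanSpace ℝ (Fin (n + 1)))
    (hA : ∀ x y, ⟪A x, y⟫ = -⟪x, A y⟫)
    (f : EuclideanSpace ℝ (Fin (n + 1)) → ℝ) (hf : ContDiff ℝ 1 f) :
    ∫ p, fderiv ℝ f p (A p) ∂smeasure n k = 0 := by
  have := smeasure_fin n k hk
  have hf' : Continuous (fun p => fderiv ℝ f p (A p)) :=
    (hf.continuous_fderiv one_ne_zero).clm_apply A.continuous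
  obtain ⟨C, hC⟩ := (sph_compact n k).exists_bound_of_continuousOn hf'.continuousOn
  have hinv : ∀ t : ℝ, ∀ p ∈ Sph n k, NormedSpace.exp (t • A) p ∈ Sph n k := by
    intro t p hp
    obtain ⟨e, he⟩ := exp_skew A hA t
    rw [← he]
    simpa [Sph] using hp
  have key := (hasDerivAt_integral_of_dominated_loc_of_deriv_le (μ := smeasure n k)
    (F := fun (t : ℝ) p => f (NormedSpace.exp (t • A) p))
    (F' := fun (t : ℝ) p => fderiv ℝ f (NormedSpace.exp (t • A) p) (A (NormedSpace.exp (t • A) p)))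
    (x₀ := 0) (s := univ) (bound := fun _ => C) Filter.univ_mem
    (Filter.Eventually.of_forall fun t =>
      (hf.continuous.comp (ContinuousLinearMap.continuous _)).aestronglyMeasurable)
    (cont_integrable_s5 hk (hf.continuous.comp (ContinuousLinearMap.continuous _)))
    (hf'.comp (ContinuousLinearMap.continuous _)).aestronglyMeasurable
    (by
      filter_upwards [ae_mem_sph n k] with p hp t _
      exact hC _ (hinv t p hp))
    (integrable_const _)
    (Filter.Eventually.of_forall fun p t _ =>
      ((hf.differentiable one_ne_zero _).hasFDerivAt.comp_hasDerivAt t (exp_hasDeriv A t p)))).2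
  have hconst : (fun t : ℝ => ∫ p, f (NormedSpace.exp (t • A) p) ∂smeasure n k) =
      fun _ => ∫ p, f p ∂smeasure n k := by
    funext t
    obtain ⟨e, he⟩ := exp_skew A hA t
    simp only [← he]
    exact smeasure_integral_comp n k e f
  rw [hconst] at key
  have := key.unique (hasDerivAt_const _ _)
  simpa only [exp_zero_apply] using this

/-- the skew operator `x ↦ ⟪a,x⟫ b - ⟪b,x⟫ a` -/
noncomputable def skewOp {n : ℕ} (a b : EuclideanSpace ℝ (Fin (n + 1))) :
    EuclideanSpace ℝ (Fin (n + 1)) →L[ℝ] EuclideanSpace ℝ (Fin (n + 1)) :=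
  (innerSL ℝ a).smulRight b - (innerSL ℝ b).smulRight a

lemma skewOp_apply {n : ℕ} (a b x : EuclideanSpace ℝ (Fin (n + 1))) :
    skewOp a b x = ⟪a, x⟫ • b - ⟪b, x⟫ • a := by
  simp [skewOp]

lemma skewOp_skew {n : ℕ} (a b : EuclideanSpace ℝ (Fin (n + 1))) (x y) :
    ⟪skewOp a b x, y⟫ = -⟪x, skewOp a b y⟫ := by
  simp only [skewOp_apply, inner_sub_left, inner_sub_right, inner_smul_left, inner_smul_right,
    real_inner_comm x, conj_trivial]
  ring

/-- differentiated tangency -/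
lemma tangent_deriv {n : ℕ} {k : ℝ} (hk : 0 < k)
    {X : EuclideanSpace ℝ (Fin (n + 1)) → EuclideanSpace ℝ (Fin (n + 1))}
    (hX : Differentiable ℝ X) (hT : IsTangent n k X)
    {p : EuclideanSpace ℝ (Fin (n + 1))} (hp : p ∈ Sph n k)
    (u : EuclideanSpace ℝ (Fin (n + 1))) (hu : ⟪u, p⟫ = 0) :
    ⟪fderiv ℝ X p u, p⟫ = -⟪X p, u⟫ := by
  have hpp : ⟪p, p⟫ = 1 / k ^ 2 := by
    have h1 : ‖p‖ = 1 / k := by simpa [Sph] using hp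
    rw [real_inner_self_eq_norm_sq, h1]; ring
  let A := skewOp p (k ^ 2 • u)
  have hAp : A p = u := by
    simp only [A, skewOp_apply, hpp, inner_smul_left, hu]
    simp [smul_smul, hk.ne']
  have hc : HasDerivAt (fun t : ℝ => NormedSpace.exp (t • A) p) u 0 := by
    have := exp_hasDeriv A 0 p
    rwa [exp_zero_apply, hAp] at this
  have hc0 : NormedSpace.exp ((0 : ℝ) • A) p = p := exp_zero_apply A p
  have hXc : HasDerivAt (fun t : ℝ => X (NormedSpace.exp (t • A) p)) (fderiv ℝ X p u) 0 := by
    have h := (hX (NormedSpace.exp ((0 : ℝ) • A) p)).hasFDerivAt.comp_hasDerivAt (0 : ℝ) hc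
    rw [hc0] at h
    exact h
  have hi := hXc.inner ℝ hc
  have hz : (fun t : ℝ => ⟪X (NormedSpace.exp (t • A) p), NormedSpace.exp (t • A) p⟫) =
      fun _ => (0 : ℝ) := by
    funext t
    apply hT
    obtain ⟨e, he⟩ := exp_skew A (skewOp_skew _ _) t
    rw [← he]
    simpa [Sph] using hp
  rw [hz] at hi
  have := hi.unique (hasDerivAt_const _ _)
  rw [hc0] at this
  linarith

lemma inner_sum_eq {n : ℕ} (x y : EuclideanSpace ℝ (Fin (n + 1))) :
    ⟪x, y⟫ = ∑ i, x i * y i := by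
  simp [PiLp.inner_apply, mul_comm]

lemma inner_single_eq {n : ℕ} (x : EuclideanSpace ℝ (Fin (n + 1))) (i : Fin (n + 1)) :
    ⟪x, EuclideanSpace.single i 1⟫ = x i := by
  rw [real_inner_comm, EuclideanSpace.inner_single_left]
  simp

lemma clm_sum {n : ℕ}
    (L : EuclideanSpace ℝ (Fin (n + 1)) →L[ℝ] EuclideanSpace ℝ (Fin (n + 1)))
    (x : EuclideanSpace ℝ (Fin (n + 1))) :
    L x = ∑ j, x j • L (EuclideanSpace.single j 1) := by
  have h : x = ∑ j, x j • EuclideanSpace.single j (1 : ℝ) := by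
    have := (EuclideanSpace.basisFun (Fin (n + 1)) ℝ).sum_repr x
    simpa using this.symm
  conv_lhs => rw [h]
  simp [map_sum]

lemma clm_sum_apply {n : ℕ}
    (L : EuclideanSpace ℝ (Fin (n + 1)) →L[ℝ] EuclideanSpace ℝ (Fin (n + 1)))
    (x : EuclideanSpace ℝ (Fin (n + 1))) (i : Fin (n + 1)) :
    (L x) i = ∑ j, x j * (L (EuclideanSpace.single j 1)) i := by
  conv_lhs => rw [clm_sum L x]
  simp

lemma clm_sum_inner {n : ℕ}
    (L : EuclideanSpace ℝ (Fin (n + 1)) →L[ℝ] EuclideanSpace ℝ (Fin (n + 1)))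
    (x y : EuclideanSpace ℝ (Fin (n + 1))) :
    ⟪L x, y⟫ = ∑ j, x j * ⟪L (EuclideanSpace.single j 1), y⟫ := by
  conv_lhs => rw [clm_sum L x]
  simp [sum_inner, inner_smul_left]

/-- the tangential trace of `L` at `p` -/
noncomputable def tauP {n : ℕ} (k : ℝ) (p : EuclideanSpace ℝ (Fin (n + 1)))
    (L : EuclideanSpace ℝ (Fin (n + 1)) →L[ℝ] EuclideanSpace ℝ (Fin (n + 1))) : ℝ :=
  ∑ i, (L (EuclideanSpace.single i 1)) i - k ^ 2 * ⟪L p, p⟫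

lemma sph_inner {n : ℕ} {k : ℝ} (hk : 0 < k) {p : EuclideanSpace ℝ (Fin (n + 1))}
    (hp : p ∈ Sph n k) : k ^ 2 * ⟪p, p⟫ = 1 := by
  have h1 : ‖p‖ = 1 / k := by simpa [Sph] using hp
  rw [real_inner_self_eq_norm_sq, h1]
  field_simp

lemma fderiv_coord {n : ℕ} {Y : EuclideanSpace ℝ (Fin (n + 1)) → EuclideanSpace ℝ (Fin (n + 1))}
    (hY : ContDiff ℝ 1 Y) (i j : Fin (n + 1)) (p u : EuclideanSpace ℝ (Fin (n + 1))) :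
    fderiv ℝ (fun q => q j * Y q i) p u = u j * Y p i + p j * (fderiv ℝ Y p u) i := by
  have h1 : HasFDerivAt (fun q : EuclideanSpace ℝ (Fin (n + 1)) => q j)
      (EuclideanSpace.proj j : EuclideanSpace ℝ (Fin (n + 1)) →L[ℝ] ℝ) p :=
    (EuclideanSpace.proj j : EuclideanSpace ℝ (Fin (n + 1)) →L[ℝ] ℝ).hasFDerivAt
  have h2 : HasFDerivAt (fun q => Y q i)
      ((EuclideanSpace.proj i : EuclideanSpace ℝ (Fin (n + 1)) →L[ℝ] ℝ).comp (fderiv ℝ Y p)) p :=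
    (EuclideanSpace.proj i : EuclideanSpace ℝ (Fin (n + 1)) →L[ℝ] ℝ).hasFDerivAt.comp p
      (hY.differentiable one_ne_zero p).hasFDerivAt
  have h3 : HasFDerivAt (fun q => q j * Y q i) _ p := h1.mul h2
  rw [h3.fderiv]
  simp
  ring

lemma div_pointwise {n : ℕ} {k : ℝ} (hk : 0 < k)
    {Y : EuclideanSpace ℝ (Fin (n + 1)) → EuclideanSpace ℝ (Fin (n + 1))}
    (hY : ContDiff ℝ 1 Y) {p : EuclideanSpace ℝ (Fin (n + 1))} (hp : p ∈ Sph n k) :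
    k ^ 2 * ∑ i, ∑ j, fderiv ℝ (fun q => q j * Y q i) p
      (skewOp (EuclideanSpace.single j 1) (EuclideanSpace.single i 1) p) =
    tauP k p (fderiv ℝ Y p) - n * k ^ 2 * ⟪Y p, p⟫ := by
  have hs := sph_inner hk hp
  set D := fderiv ℝ Y p with hD
  have hterm : ∀ i j, fderiv ℝ (fun q => q j * Y q i) p
      (skewOp (EuclideanSpace.single j 1) (EuclideanSpace.single i 1) p) =
      (if j = i then p j * Y p i else 0) - p i * Y p i +
      ((p j * p j) * (D (EuclideanSpace.single i 1)) i
        - p i * (p j * (D (EuclideanSpace.single j 1)) i)) := by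
    intro i j
    rw [fderiv_coord hY, skewOp_apply]
    simp only [EuclideanSpace.inner_single_left, map_sub, map_smul, PiLp.sub_apply, PiLp.smul_apply,
      smul_eq_mul, map_one, one_mul, ← hD]
    simp only [PiLp.single_apply]
    split_ifs <;> simp <;> ring
  simp only [hterm]
  have e1 : ∀ i, ∑ j, ((if j = i then p j * Y p i else 0) - p i * Y p i +
      ((p j * p j) * (D (EuclideanSpace.single i 1)) i
        - p i * (p j * (D (EuclideanSpace.single j 1)) i))) =
      - n * (Y p i * p i) + (⟪p, p⟫ * (D (EuclideanSpace.single i 1)) i - (D p) i * p i) := by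
    intro i
    rw [Finset.sum_add_distrib, Finset.sum_sub_distrib, Finset.sum_sub_distrib,
      ← Finset.mul_sum Finset.univ (fun j => p j * (D (EuclideanSpace.single j 1)) i),
      ← clm_sum_apply, ← Finset.sum_mul Finset.univ (fun j => p j * p j), ← inner_sum_eq]
    simp
    ring
  simp only [e1]
  rw [Finset.sum_add_distrib, Finset.sum_sub_distrib, ← Finset.mul_sum, ← Finset.mul_sum,
    ← inner_sum_eq, ← inner_sum_eq, tauP]
  linear_combination (∑ i, (D (EuclideanSpace.single i 1)) i) * hs

lemma div_thm {n : ℕ} {k : ℝ} (hk : 0 < k)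
    {Y : EuclideanSpace ℝ (Fin (n + 1)) → EuclideanSpace ℝ (Fin (n + 1))}
    (hY : ContDiff ℝ 1 Y) :
    ∫ p, (tauP k p (fderiv ℝ Y p) - n * k ^ 2 * ⟪Y p, p⟫) ∂smeasure n k = 0 := by
  have hc : ∀ i j : Fin (n + 1), ContDiff ℝ 1 (fun q => q j * Y q i) := by
    intro i j
    have h2 : ContDiff ℝ 1 (fun q => Y q i) := contDiff_euclidean.1 hY i
    have h1 : ContDiff ℝ 1 (fun q : EuclideanSpace ℝ (Fin (n + 1)) => q j) := by fun_prop
    exact h1.mul h2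
  have hint : ∀ i j : Fin (n + 1), Integrable (fun p => fderiv ℝ (fun q => q j * Y q i) p
      (skewOp (EuclideanSpace.single j 1) (EuclideanSpace.single i 1) p)) (smeasure n k) :=
    fun i j => cont_integrable_s5 hk
      (((hc i j).continuous_fderiv one_ne_zero).clm_apply (ContinuousLinearMap.continuous _))
  have h : ∫ p, (tauP k p (fderiv ℝ Y p) - n * k ^ 2 * ⟪Y p, p⟫) ∂smeasure n k =
      ∫ p, k ^ 2 * ∑ i, ∑ j, fderiv ℝ (fun q => q j * Y q i) p
      (skewOp (EuclideanSpace.single j 1) (EuclideanSpace.single i 1) p) ∂smeasure n k := by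
    refine integral_congr_ae ?_
    filter_upwards [ae_mem_sph n k] with p hp
    exact (div_pointwise hk hY hp).symm
  rw [h, integral_const_mul, integral_finsetSum _ (fun i _ => integrable_finsetSum _ fun j _ => hint i j)]
  have : ∀ i : Fin (n + 1), ∫ p, ∑ j, fderiv ℝ (fun q => q j * Y q i) p
      (skewOp (EuclideanSpace.single j 1) (EuclideanSpace.single i 1) p) ∂smeasure n k = 0 := by
    intro i
    rw [integral_finsetSum _ (fun j _ => hint i j)]
    exact Finset.sum_eq_zero fun j _ => integral_skew hk _ (skewOp_skew _ _) _ (hc i j)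
  simp [this]

/-- tangential projection as a continuous linear map -/
noncomputable def PPc {n : ℕ} (k : ℝ) (p : EuclideanSpace ℝ (Fin (n + 1))) :
    EuclideanSpace ℝ (Fin (n + 1)) →L[ℝ] EuclideanSpace ℝ (Fin (n + 1)) :=
  ContinuousLinearMap.id ℝ _ - k ^ 2 • (innerSL ℝ p).smulRight p

lemma PPc_apply {n : ℕ} (k : ℝ) (p u : EuclideanSpace ℝ (Fin (n + 1))) :
    PPc k p u = u - (k ^ 2 * ⟪u, p⟫) • p := by
  simp [PPc, smul_smul, real_inner_comm]

lemma PPc_sym {n : ℕ} (k : ℝ) (p u v : EuclideanSpace ℝ (Fin (n + 1))) :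
    ⟪PPc k p u, v⟫ = ⟪u, PPc k p v⟫ := by
  simp only [PPc_apply, inner_sub_left, inner_sub_right, inner_smul_left, inner_smul_right,
    conj_trivial, real_inner_comm p]
  ring

lemma PPc_self {n : ℕ} {k : ℝ} {p : EuclideanSpace ℝ (Fin (n + 1))}
    (hs : k ^ 2 * ⟪p, p⟫ = 1) : PPc k p p = 0 := by
  rw [PPc_apply, hs, one_smul, sub_self]

lemma PPc_orth {n : ℕ} {k : ℝ} {p : EuclideanSpace ℝ (Fin (n + 1))}
    (hs : k ^ 2 * ⟪p, p⟫ = 1) (u : EuclideanSpace ℝ (Fin (n + 1))) : ⟪PPc k p u, p⟫ = 0 := by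
  rw [PPc_sym, PPc_self hs, inner_zero_right]

lemma PPc_of_orth {n : ℕ} {k : ℝ} {p u : EuclideanSpace ℝ (Fin (n + 1))}
    (hu : ⟪u, p⟫ = 0) : PPc k p u = u := by
  rw [PPc_apply, hu]; simp

lemma PPc_idem {n : ℕ} {k : ℝ} {p : EuclideanSpace ℝ (Fin (n + 1))}
    (hs : k ^ 2 * ⟪p, p⟫ = 1) (u : EuclideanSpace ℝ (Fin (n + 1))) :
    PPc k p (PPc k p u) = PPc k p u := PPc_of_orth (PPc_orth hs u)

lemma tau_eq {n : ℕ} {k : ℝ} {p : EuclideanSpace ℝ (Fin (n + 1))}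
    (hs : k ^ 2 * ⟪p, p⟫ = 1)
    (L : EuclideanSpace ℝ (Fin (n + 1)) →L[ℝ] EuclideanSpace ℝ (Fin (n + 1))) :
    ∑ i, ⟪L (PPc k p (EuclideanSpace.single i 1)), PPc k p (EuclideanSpace.single i 1)⟫ =
      tauP k p L := by
  have e : ∀ i : Fin (n + 1),
      ⟪L (PPc k p (EuclideanSpace.single i 1)), PPc k p (EuclideanSpace.single i 1)⟫ =
      (L (EuclideanSpace.single i 1)) i - k ^ 2 * (p i * ⟪L (EuclideanSpace.single i 1), p⟫)
      - k ^ 2 * ((L p) i * p i) + k ^ 2 * (k ^ 2 * ⟪L p, p⟫) * (p i * p i) := by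
    intro i
    simp only [PPc_apply, map_sub, map_smul, inner_sub_left, inner_sub_right, inner_smul_left,
      inner_smul_right, conj_trivial, inner_single_eq, EuclideanSpace.inner_single_left]
    ring
  simp only [e]
  rw [Finset.sum_add_distrib, Finset.sum_sub_distrib, Finset.sum_sub_distrib, ← Finset.mul_sum,
    ← Finset.mul_sum, ← Finset.mul_sum, ← inner_sum_eq, ← inner_sum_eq, ← clm_sum_inner, tauP]
  linear_combination (k ^ 2 * ⟪L p, p⟫) * hs

/-- the covariant derivative as a continuous linear map -/
noncomputable def covL {n : ℕ} (k : ℝ) (p : EuclideanSpace ℝ (Fin (n + 1)))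
    (D : EuclideanSpace ℝ (Fin (n + 1)) →L[ℝ] EuclideanSpace ℝ (Fin (n + 1))) :
    EuclideanSpace ℝ (Fin (n + 1)) →L[ℝ] EuclideanSpace ℝ (Fin (n + 1)) :=
  (PPc k p).comp (D.comp (PPc k p))

lemma covL_apply {n : ℕ} (k : ℝ) (p u : EuclideanSpace ℝ (Fin (n + 1)))
    (D : EuclideanSpace ℝ (Fin (n + 1)) →L[ℝ] EuclideanSpace ℝ (Fin (n + 1))) :
    covL k p D u = PPc k p (D (PPc k p u)) := rfl

lemma covD_eq {n : ℕ} (k : ℝ) (X : EuclideanSpace ℝ (Fin (n + 1)) → EuclideanSpace ℝ (Fin (n + 1)))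
    (p u : EuclideanSpace ℝ (Fin (n + 1))) :
    covD n k X p u = covL k p (fderiv ℝ X p) u := by
  simp only [covL_apply, covD, tproj, PPc_apply]

/-- matrix entries of the covariant derivative -/
noncomputable def aM {n : ℕ} (k : ℝ) (p : EuclideanSpace ℝ (Fin (n + 1)))
    (D : EuclideanSpace ℝ (Fin (n + 1)) →L[ℝ] EuclideanSpace ℝ (Fin (n + 1)))
    (i j : Fin (n + 1)) : ℝ := (covL k p D (EuclideanSpace.single j 1)) i

lemma covNormSq_eq {n : ℕ} (k : ℝ)
    (X : EuclideanSpace ℝ (Fin (n + 1)) → EuclideanSpace ℝ (Fin (n + 1)))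
    (p : EuclideanSpace ℝ (Fin (n + 1))) :
    covNormSq n k X p = ∑ i, ∑ j, aM k p (fderiv ℝ X p) i j ^ 2 := by
  rw [Finset.sum_comm]
  rw [covNormSq]
  refine Finset.sum_congr rfl fun i _ => ?_
  rw [covD_eq, ← real_inner_self_eq_norm_sq, inner_sum_eq]
  simp only [aM, sq]

lemma aM_trace {n : ℕ} {k : ℝ} {p : EuclideanSpace ℝ (Fin (n + 1))}
    (hs : k ^ 2 * ⟪p, p⟫ = 1)
    (D : EuclideanSpace ℝ (Fin (n + 1)) →L[ℝ] EuclideanSpace ℝ (Fin (n + 1))) :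
    ∑ i, aM k p D i i = tauP k p D := by
  rw [← tau_eq hs]
  refine Finset.sum_congr rfl fun i _ => ?_
  rw [aM, ← inner_single_eq, covL_apply, PPc_sym]

lemma aM_trace_sq {n : ℕ} {k : ℝ} {p x : EuclideanSpace ℝ (Fin (n + 1))}
    (hs : k ^ 2 * ⟪p, p⟫ = 1)
    (D : EuclideanSpace ℝ (Fin (n + 1)) →L[ℝ] EuclideanSpace ℝ (Fin (n + 1)))
    (hx : ⟪x, p⟫ = 0) (hD : ∀ u, ⟪u, p⟫ = 0 → ⟪D u, p⟫ = -⟪x, u⟫) :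
    ∑ i, ∑ j, aM k p D i j * aM k p D j i =
      tauP k p (D.comp D) + k ^ 2 * ⟪D p, x⟫ := by
  have h1 : ∑ i, ∑ j, aM k p D i j * aM k p D j i = tauP k p (D.comp ((PPc k p).comp D)) := by
    rw [← tau_eq hs]
    refine Finset.sum_congr rfl fun i _ => ?_
    have h2 : ∑ j, aM k p D i j * aM k p D j i =
        (covL k p D (covL k p D (EuclideanSpace.single i 1))) i := by
      rw [clm_sum_apply]
      refine Finset.sum_congr rfl fun j _ => ?_
      simp only [aM]
      ring
    rw [h2, ← inner_single_eq, covL_apply, covL_apply, PPc_idem hs, PPc_sym]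
    rfl
  rw [h1]
  have h3 : ∀ u, (D.comp ((PPc k p).comp D)) u = (D.comp D) u - (k ^ 2 * ⟪D u, p⟫) • D p := by
    intro u
    simp [PPc_apply]
  have h4 : ⟪D (D p), p⟫ - k ^ 2 * ⟪D p, p⟫ * ⟪D p, p⟫ = -⟪D p, x⟫ := by
    have h5 := hD (PPc k p (D p)) (PPc_orth hs _)
    rw [← PPc_sym, PPc_of_orth hx, PPc_apply, map_sub, map_smul, inner_sub_left, inner_smul_left,
      real_inner_comm (D p) x] at h5
    simpa using h5
  have h6 : ∑ i, (D.comp ((PPc k p).comp D)) (EuclideanSpace.single i 1) i =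
      ∑ i, (D.comp D) (EuclideanSpace.single i 1) i - k ^ 2 * ⟪D (D p), p⟫ := by
    rw [clm_sum_inner D (D p) p, Finset.mul_sum, ← Finset.sum_sub_distrib]
    refine Finset.sum_congr rfl fun i _ => ?_
    rw [h3]
    simp
    ring
  rw [tauP, tauP, h6, h3, inner_sub_left, inner_smul_left]
  simp only [conj_trivial, ContinuousLinearMap.comp_apply]
  linear_combination (-k ^ 2) * h4

/-- entries of the projection -/
noncomputable def pM {n : ℕ} (k : ℝ) (p : EuclideanSpace ℝ (Fin (n + 1)))
    (i j : Fin (n + 1)) : ℝ := (if i = j then 1 else 0) - k ^ 2 * (p i * p j)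

lemma pM_eq {n : ℕ} (k : ℝ) (p : EuclideanSpace ℝ (Fin (n + 1))) (i j : Fin (n + 1)) :
    (PPc k p (EuclideanSpace.single j 1)) i = pM k p i j := by
  rw [PPc_apply, pM]
  simp [EuclideanSpace.inner_single_left]
  ring

lemma pM_sum {n : ℕ} {k : ℝ} {p : EuclideanSpace ℝ (Fin (n + 1))} (f : Fin (n + 1) → Fin (n + 1) → ℝ) :
    ∑ i, ∑ j, f i j * pM k p i j = ∑ i, f i i - k ^ 2 * ∑ i, ∑ j, f i j * (p i * p j) := by
  simp only [pM, mul_sub, Finset.sum_sub_distrib]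
  congr 1
  · simp
  · simp only [Finset.mul_sum]
    refine Finset.sum_congr rfl fun i _ => Finset.sum_congr rfl fun j _ => ?_
    ring

lemma pM_trace {n : ℕ} {k : ℝ} {p : EuclideanSpace ℝ (Fin (n + 1))}
    (hs : k ^ 2 * ⟪p, p⟫ = 1) : ∑ i, pM k p i i = n := by
  simp only [pM, Finset.sum_sub_distrib, ← Finset.mul_sum, ← inner_sum_eq, hs]
  simp

lemma pM_symm {n : ℕ} (k : ℝ) (p : EuclideanSpace ℝ (Fin (n + 1))) (i j : Fin (n + 1)) :
    pM k p i j = pM k p j i := by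
  simp only [pM, eq_comm (a := i), mul_comm (p i)]

lemma pM_sq {n : ℕ} {k : ℝ} {p : EuclideanSpace ℝ (Fin (n + 1))}
    (hs : k ^ 2 * ⟪p, p⟫ = 1) : ∑ i, ∑ j, pM k p i j ^ 2 = n := by
  simp only [sq (pM _ _ _ _)]
  rw [pM_sum, pM_trace hs]
  have : ∀ i, ∑ j, pM k p i j * (p i * p j) = 0 := by
    intro i
    have h := clm_sum_apply (PPc k p) p i
    rw [PPc_self hs] at h
    simp only [pM_eq] at h
    have h' : ∑ j, pM k p i j * (p i * p j) = p i * ∑ j, p j * pM k p i j := by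
      rw [Finset.mul_sum]
      refine Finset.sum_congr rfl fun j _ => ?_
      ring
    rw [h', ← h]
    simp
  simp [this]

lemma aM_pp {n : ℕ} {k : ℝ} {p : EuclideanSpace ℝ (Fin (n + 1))}
    (hs : k ^ 2 * ⟪p, p⟫ = 1)
    (D : EuclideanSpace ℝ (Fin (n + 1)) →L[ℝ] EuclideanSpace ℝ (Fin (n + 1))) :
    ∑ i, ∑ j, aM k p D i j * (p i * p j) = 0 := by
  have : ∀ i, ∑ j, aM k p D i j * (p i * p j) = 0 := by
    intro i
    have h := clm_sum_apply (covL k p D) p i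
    rw [covL_apply, PPc_self hs, map_zero, map_zero] at h
    have h' : ∑ j, aM k p D i j * (p i * p j) =
        p i * ∑ j, p j * (covL k p D (EuclideanSpace.single j 1)) i := by
      rw [Finset.mul_sum]
      refine Finset.sum_congr rfl fun j _ => ?_
      rw [aM]
      ring
    rw [h', ← h]
    simp
  simp [this]

lemma aM_ineq {n : ℕ} (hn : 2 ≤ n) {k : ℝ} {p : EuclideanSpace ℝ (Fin (n + 1))}
    (hs : k ^ 2 * ⟪p, p⟫ = 1)
    (D : EuclideanSpace ℝ (Fin (n + 1)) →L[ℝ] EuclideanSpace ℝ (Fin (n + 1))) :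
    (∑ i, aM k p D i i) ^ 2 - ∑ i, ∑ j, aM k p D i j * aM k p D j i ≤
      (n - 1) * ∑ i, ∑ j, aM k p D i j ^ 2 := by
  set a := aM k p D with ha
  have hsw : ∑ i, ∑ j, a j i ^ 2 = ∑ i, ∑ j, a i j ^ 2 := Finset.sum_comm
  have hS : ∑ i, ∑ j, ((a i j + a j i) / 2) ^ 2 =
      (∑ i, ∑ j, a i j ^ 2 + ∑ i, ∑ j, a i j * a j i) / 2 := by
    have : ∀ i j, ((a i j + a j i) / 2) ^ 2 =
        a i j ^ 2 / 4 + a j i ^ 2 / 4 + (a i j * a j i) / 2 := fun i j => by ring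
    simp only [this, Finset.sum_add_distrib, ← Finset.sum_div, hsw]
    ring
  have hW : ∑ i, ∑ j, ((a i j - a j i) / 2) ^ 2 =
      (∑ i, ∑ j, a i j ^ 2 - ∑ i, ∑ j, a i j * a j i) / 2 := by
    have : ∀ i j, ((a i j - a j i) / 2) ^ 2 =
        a i j ^ 2 / 4 + a j i ^ 2 / 4 - (a i j * a j i) / 2 := fun i j => by ring
    simp only [this, Finset.sum_add_distrib, Finset.sum_sub_distrib, ← Finset.sum_div, hsw]
    ring
  have hW0 : 0 ≤ ∑ i, ∑ j, ((a i j - a j i) / 2) ^ 2 :=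
    Finset.sum_nonneg fun i _ => Finset.sum_nonneg fun j _ => sq_nonneg _
  have htr : ∑ i, ∑ j, ((a i j + a j i) / 2) * pM k p i j = ∑ i, a i i := by
    have h1 : ∑ i, ∑ j, a i j * pM k p i j = ∑ i, a i i := by
      rw [pM_sum, ha, aM_pp hs, mul_zero, sub_zero]
    have h2 : ∑ i, ∑ j, a j i * pM k p i j = ∑ i, a i i := by
      rw [Finset.sum_comm]
      rw [← h1]
      refine Finset.sum_congr rfl fun i _ => Finset.sum_congr rfl fun j _ => ?_
      rw [pM_symm]
    have h3 : ∀ i j, ((a i j + a j i) / 2) * pM k p i j =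
      (a i j * pM k p i j) / 2 + (a j i * pM k p i j) / 2 := fun i j => by ring
    simp only [h3, Finset.sum_add_distrib, ← Finset.sum_div, h1, h2]
    ring
  have hCS := Finset.sum_mul_sq_le_sq_mul_sq (Finset.univ : Finset (Fin (n + 1) × Fin (n + 1)))
    (fun x => (a x.1 x.2 + a x.2 x.1) / 2) (fun x => pM k p x.1 x.2)
  simp only [Fintype.sum_prod_type] at hCS
  rw [htr, pM_sq hs, hS] at hCS
  rw [hW] at hW0
  have hn' : (2 : ℝ) ≤ n := by exact_mod_cast hn
  nlinarith [mul_nonneg (sub_nonneg.2 hn') hW0]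

lemma tauP_contDiff {n : ℕ} (k : ℝ)
    {G : EuclideanSpace ℝ (Fin (n + 1)) →
      EuclideanSpace ℝ (Fin (n + 1)) →L[ℝ] EuclideanSpace ℝ (Fin (n + 1))}
    (hG : ContDiff ℝ 1 G) : ContDiff ℝ 1 (fun q => tauP k q (G q)) := by
  unfold tauP
  refine ContDiff.sub (ContDiff.sum fun i _ => ?_) (contDiff_const.mul ?_)
  · exact contDiff_euclidean.1 (hG.clm_apply contDiff_const) i
  · exact (hG.clm_apply contDiff_id).inner ℝ contDiff_id

lemma tauP_fderiv {n : ℕ} (k : ℝ)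
    {G : EuclideanSpace ℝ (Fin (n + 1)) →
      EuclideanSpace ℝ (Fin (n + 1)) →L[ℝ] EuclideanSpace ℝ (Fin (n + 1))}
    (hG : ContDiff ℝ 1 G) (p u : EuclideanSpace ℝ (Fin (n + 1))) :
    fderiv ℝ (fun q => tauP k q (G q)) p u =
      ∑ i, (fderiv ℝ G p u (EuclideanSpace.single i 1)) i -
        k ^ 2 * (⟪G p p, u⟫ + ⟪fderiv ℝ G p u p + G p u, p⟫) := by
  have hc : HasDerivAt (fun s : ℝ => p + s • u) u 0 := by
    simpa using ((hasDerivAt_id (0 : ℝ)).smul_const u).const_add p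
  have hc0 : p + (0 : ℝ) • u = p := by simp
  have hGc : HasDerivAt (fun s : ℝ => G (p + s • u)) (fderiv ℝ G p u) 0 := by
    have h := (hG.differentiable one_ne_zero (p + (0 : ℝ) • u)).hasFDerivAt.comp_hasDerivAt
      (0 : ℝ) hc
    rw [hc0] at h
    exact h
  have hl : HasDerivAt (fun s : ℝ => tauP k (p + s • u) (G (p + s • u)))
      (fderiv ℝ (fun q => tauP k q (G q)) p u) 0 := by
    have h := ((tauP_contDiff k hG).differentiable one_ne_zero
      (p + (0 : ℝ) • u)).hasFDerivAt.comp_hasDerivAt (0 : ℝ) hc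
    rw [hc0] at h
    exact h
  refine hl.unique ?_
  unfold tauP
  refine HasDerivAt.sub (HasDerivAt.fun_sum fun i _ => ?_) (HasDerivAt.const_mul _ ?_)
  · have h1 := hGc.clm_apply (hasDerivAt_const (0 : ℝ) (EuclideanSpace.single i (1 : ℝ)))
    have h2 := (EuclideanSpace.proj i : EuclideanSpace ℝ (Fin (n + 1)) →L[ℝ] ℝ).hasFDerivAt.comp_hasDerivAt
      (0 : ℝ) h1
    refine h2.congr_deriv ?_
    simp
  · have h1 := (hGc.clm_apply hc).inner ℝ hc
    refine h1.congr_deriv ?_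
    simp only [hc0]

/-- the vector field whose divergence is computed -/
noncomputable def bochY {n : ℕ} (k : ℝ)
    (X : EuclideanSpace ℝ (Fin (n + 1)) → EuclideanSpace ℝ (Fin (n + 1)))
    (q : EuclideanSpace ℝ (Fin (n + 1))) : EuclideanSpace ℝ (Fin (n + 1)) :=
  tauP k q (fderiv ℝ X q) • X q - fderiv ℝ X q (X q)

lemma fderiv_contDiff {n : ℕ} {X : EuclideanSpace ℝ (Fin (n + 1)) → EuclideanSpace ℝ (Fin (n + 1))}
    (hX : ContDiff ℝ (⊤ : ℕ∞) X) : ContDiff ℝ 1 (fderiv ℝ X) :=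
  hX.fderiv_right (by norm_cast)

lemma contDiff_one {n : ℕ} {X : EuclideanSpace ℝ (Fin (n + 1)) → EuclideanSpace ℝ (Fin (n + 1))}
    (hX : ContDiff ℝ (⊤ : ℕ∞) X) : ContDiff ℝ 1 X := hX.of_le (by norm_cast)

lemma bochY_contDiff {n : ℕ} (k : ℝ)
    {X : EuclideanSpace ℝ (Fin (n + 1)) → EuclideanSpace ℝ (Fin (n + 1))}
    (hX : ContDiff ℝ (⊤ : ℕ∞) X) : ContDiff ℝ 1 (bochY k X) :=
  ((tauP_contDiff k (fderiv_contDiff hX)).smul (contDiff_one hX)).sub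
    ((fderiv_contDiff hX).clm_apply (contDiff_one hX))

lemma bochY_fderiv {n : ℕ} (k : ℝ)
    {X : EuclideanSpace ℝ (Fin (n + 1)) → EuclideanSpace ℝ (Fin (n + 1))}
    (hX : ContDiff ℝ (⊤ : ℕ∞) X) (p u : EuclideanSpace ℝ (Fin (n + 1))) :
    fderiv ℝ (bochY k X) p u =
      (fderiv ℝ (fun q => tauP k q (fderiv ℝ X q)) p u) • X p
      + tauP k p (fderiv ℝ X p) • fderiv ℝ X p u
      - (fderiv ℝ (fderiv ℝ X) p u (X p) + fderiv ℝ X p (fderiv ℝ X p u)) := by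
  have ht := ((tauP_contDiff k (fderiv_contDiff hX)).differentiable one_ne_zero p).hasFDerivAt
  have hx := ((contDiff_one hX).differentiable one_ne_zero p).hasFDerivAt
  have hg := ((fderiv_contDiff hX).differentiable one_ne_zero p).hasFDerivAt
  have h : HasFDerivAt (bochY k X) _ p := (ht.smul hx).sub (hg.clm_apply hx)
  rw [h.fderiv]
  simp
  abel

lemma bochY_tau {n : ℕ} (k : ℝ)
    {X : EuclideanSpace ℝ (Fin (n + 1)) → EuclideanSpace ℝ (Fin (n + 1))}
    (hX : ContDiff ℝ (⊤ : ℕ∞) X) (p : EuclideanSpace ℝ (Fin (n + 1))) (hx : ⟪X p, p⟫ = 0) :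
    tauP k p (fderiv ℝ (bochY k X) p) =
      tauP k p (fderiv ℝ X p) ^ 2 - tauP k p ((fderiv ℝ X p).comp (fderiv ℝ X p))
      - k ^ 2 * (⟪fderiv ℝ X p p, X p⟫ + ⟪fderiv ℝ X p (X p), p⟫) := by
  set D := fderiv ℝ X p with hD
  set H := fderiv ℝ (fderiv ℝ X) p with hH
  set φ := fderiv ℝ (fun q => tauP k q (fderiv ℝ X q)) p with hφ
  have hsymm : ∀ u v, H u v = H v u := by
    intro u v
    have := (hX.contDiffAt (x := p)).isSymmSndFDerivAt (by simp; norm_cast)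
    exact this u v
  have hM : ∀ u, fderiv ℝ (bochY k X) p u = φ u • X p + tauP k p D • D u - (H u (X p) + D (D u)) :=
    bochY_fderiv k hX p
  have hφx : ∑ i, φ (EuclideanSpace.single i 1) * X p i = φ (X p) := by
    have h := clm_sum (φ.smulRight (X p)) (X p)
    have h2 : X p = ∑ j, X p j • EuclideanSpace.single j (1 : ℝ) := by
      simpa using clm_sum (ContinuousLinearMap.id ℝ _) (X p)
    conv_rhs => rw [h2]
    rw [map_sum]
    refine Finset.sum_congr rfl fun i _ => ?_
    rw [map_smul, smul_eq_mul, mul_comm]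
  have hφv : φ (X p) = ∑ i, (H (EuclideanSpace.single i 1) (X p)) i -
        k ^ 2 * (⟪D p, X p⟫ + ⟪H p (X p) + D (X p), p⟫) := by
    rw [hφ, tauP_fderiv k (fderiv_contDiff hX), ← hH, ← hD, hsymm _ p]
    simp only [hsymm (X p)]
  have hsum : ∑ i, (fderiv ℝ (bochY k X) p (EuclideanSpace.single i 1)) i =
      φ (X p) + tauP k p D * ∑ i, (D (EuclideanSpace.single i 1)) i -
      (∑ i, (H (EuclideanSpace.single i 1) (X p)) i + ∑ i, (D (D (EuclideanSpace.single i 1))) i) := by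
    rw [← hφx, Finset.mul_sum, ← Finset.sum_add_distrib, ← Finset.sum_add_distrib,
      ← Finset.sum_sub_distrib]
    refine Finset.sum_congr rfl fun i _ => ?_
    rw [hM]
    simp
  have hin : ⟪fderiv ℝ (bochY k X) p p, p⟫ =
      tauP k p D * ⟪D p, p⟫ - (⟪H p (X p), p⟫ + ⟪D (D p), p⟫) := by
    rw [hM]
    simp only [inner_sub_left, inner_add_left, inner_smul_left, hx, conj_trivial]
    ring
  have e1 : ∑ i, (D (EuclideanSpace.single i 1)) i = tauP k p D + k ^ 2 * ⟪D p, p⟫ := by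
    rw [tauP]; ring
  have e2 : tauP k p (D.comp D) =
      ∑ i, (D (D (EuclideanSpace.single i 1))) i - k ^ 2 * ⟪D (D p), p⟫ := rfl
  rw [tauP, hsum, hin, hφv, e1, e2]
  simp only [inner_add_left, ContinuousLinearMap.comp_apply]
  ring

/-- the integrated Bochner identity -/
lemma bochner_s5 {n : ℕ} {k : ℝ} (hk : 0 < k)
    {X : EuclideanSpace ℝ (Fin (n + 1)) → EuclideanSpace ℝ (Fin (n + 1))}
    (hX : ContDiff ℝ (⊤ : ℕ∞) X) (hT : IsTangent n k X) :
    ∫ p, ((∑ i, aM k p (fderiv ℝ X p) i i) ^ 2 -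
      ∑ i, ∑ j, aM k p (fderiv ℝ X p) i j * aM k p (fderiv ℝ X p) j i) ∂smeasure n k =
    (n - 1) * k ^ 2 * ∫ p, ‖X p‖ ^ 2 ∂smeasure n k := by
  have h1 := div_thm hk (bochY_contDiff k hX)
  have hXc : Continuous X := hX.continuous
  have hYc : Continuous (bochY k X) := (bochY_contDiff k hX).continuous
  have hint : Integrable (fun p => tauP k p (fderiv ℝ (bochY k X) p) - n * k ^ 2 * ⟪bochY k X p, p⟫)
      (smeasure n k) := by
    refine cont_integrable_s5 hk ?_
    have hd := (bochY_contDiff k hX).continuous_fderiv one_ne_zero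
    unfold tauP
    refine Continuous.sub (Continuous.sub (continuous_finsetSum _ fun i _ => ?_)
      (continuous_const.mul ?_)) (continuous_const.mul ?_)
    · have : Continuous fun q => fderiv ℝ (bochY k X) q (EuclideanSpace.single i 1) :=
        hd.clm_apply continuous_const
      fun_prop
    · exact (hd.clm_apply continuous_id).inner continuous_id
    · exact hYc.inner continuous_id
  have hint2 : Integrable (fun p => (n - 1) * k ^ 2 * ‖X p‖ ^ 2) (smeasure n k) :=
    cont_integrable_s5 hk (by fun_prop)
  have hpt : ∀ p ∈ Sph n k, ((∑ i, aM k p (fderiv ℝ X p) i i) ^ 2 -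
      ∑ i, ∑ j, aM k p (fderiv ℝ X p) i j * aM k p (fderiv ℝ X p) j i) =
      (tauP k p (fderiv ℝ (bochY k X) p) - n * k ^ 2 * ⟪bochY k X p, p⟫)
      + (n - 1) * k ^ 2 * ‖X p‖ ^ 2 := by
    intro p hp
    have hs := sph_inner hk hp
    have hx := hT p hp
    have hDd := tangent_deriv hk ((contDiff_one hX).differentiable one_ne_zero) hT hp
    have hXX := hDd (X p) hx
    rw [real_inner_self_eq_norm_sq] at hXX
    rw [aM_trace hs, aM_trace_sq hs _ hx hDd, bochY_tau k hX p hx, hXX, bochY, inner_sub_left,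
      inner_smul_left, hx, hXX]
    ring
  rw [← integral_const_mul, ← zero_add (∫ p, (n - 1) * k ^ 2 * ‖X p‖ ^ 2 ∂smeasure n k), ← h1,
    ← integral_add hint hint2]
  refine integral_congr_ae ?_
  filter_upwards [ae_mem_sph n k] with p hp
  exact hpt p hp

lemma aM_cont {n : ℕ} (k : ℝ)
    {X : EuclideanSpace ℝ (Fin (n + 1)) → EuclideanSpace ℝ (Fin (n + 1))}
    (hX : ContDiff ℝ (⊤ : ℕ∞) X) (i j : Fin (n + 1)) :
    Continuous (fun p => aM k p (fderiv ℝ X p) i j) := by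
  have hd := (contDiff_one hX).continuous_fderiv one_ne_zero
  simp only [aM, covL_apply, PPc_apply]
  have h1 : Continuous fun p : EuclideanSpace ℝ (Fin (n + 1)) => (fderiv ℝ X p)
      (EuclideanSpace.single j 1 - (k ^ 2 * ⟪EuclideanSpace.single j 1, p⟫) • p) :=
    hd.clm_apply (by fun_prop)
  fun_prop

lemma covNormSq_integrable {n : ℕ} {k : ℝ} (hk : 0 < k)
    {X : EuclideanSpace ℝ (Fin (n + 1)) → EuclideanSpace ℝ (Fin (n + 1))}
    (hX : ContDiff ℝ (⊤ : ℕ∞) X) : Integrable (covNormSq n k X) (smeasure n k) := by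
  refine cont_integrable_s5 hk ?_
  have h : covNormSq n k X = fun p => ∑ i, ∑ j, aM k p (fderiv ℝ X p) i j ^ 2 :=
    funext fun p => covNormSq_eq k X p
  rw [h]
  exact continuous_finsetSum _ fun i _ => continuous_finsetSum _ fun j _ => (aM_cont k hX i j).pow 2

lemma part1 {n : ℕ} (hn : 2 ≤ n) {k : ℝ} (hk : 0 < k)
    {X : EuclideanSpace ℝ (Fin (n + 1)) → EuclideanSpace ℝ (Fin (n + 1))}
    (hX : ContDiff ℝ (⊤ : ℕ∞) X) (hT : IsTangent n k X) (h0 : ∃ p ∈ Sph n k, X p ≠ 0) :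
    k ^ 2 ≤ energy n k X := by
  have hpos := integral_normSq_pos n k hk X hX.continuous h0
  rw [energy, le_div_iff₀ hpos]
  have hb := bochner_s5 hk hX hT
  have hn' : (2 : ℝ) ≤ n := by exact_mod_cast hn
  have hle : ∫ p, ((∑ i, aM k p (fderiv ℝ X p) i i) ^ 2 -
      ∑ i, ∑ j, aM k p (fderiv ℝ X p) i j * aM k p (fderiv ℝ X p) j i) ∂smeasure n k ≤
      ∫ p, ((n : ℝ) - 1) * covNormSq n k X p ∂smeasure n k := by
    refine integral_mono_ae (cont_integrable_s5 hk ?_) ((covNormSq_integrable hk hX).const_mul _) ?_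
    · exact ((continuous_finsetSum _ fun i _ => aM_cont k hX i i).pow 2).sub
        (continuous_finsetSum _ fun i _ => continuous_finsetSum _ fun j _ =>
          (aM_cont k hX i j).mul (aM_cont k hX j i))
    · filter_upwards [ae_mem_sph n k] with p hp
      rw [covNormSq_eq]
      exact aM_ineq hn (sph_inner hk hp) _
  rw [hb, integral_const_mul, mul_assoc] at hle
  exact le_of_mul_le_mul_left hle (by linarith)

lemma energy_of_pointwise {n : ℕ} (c : ℝ) (hc : c ≠ 0) {k : ℝ} (hk : 0 < k)
    {X : EuclideanSpace ℝ (Fin (n + 1)) → EuclideanSpace ℝ (Fin (n + 1))}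
    (hX : ContDiff ℝ (⊤ : ℕ∞) X) (hT : IsTangent n k X) (h0 : ∃ p ∈ Sph n k, X p ≠ 0)
    (h : ∀ p ∈ Sph n k, ((∑ i, aM k p (fderiv ℝ X p) i i) ^ 2 -
      ∑ i, ∑ j, aM k p (fderiv ℝ X p) i j * aM k p (fderiv ℝ X p) j i) =
      c * covNormSq n k X p) : c * energy n k X = (n - 1) * k ^ 2 := by
  have hpos := integral_normSq_pos n k hk X hX.continuous h0
  have hb := bochner_s5 hk hX hT
  rw [energy, ← mul_div_assoc, div_eq_iff hpos.ne', ← hb, ← integral_const_mul]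
  refine integral_congr_ae ?_
  filter_upwards [ae_mem_sph n k] with p hp
  exact (h p hp).symm

lemma part3 {n : ℕ} {k : ℝ} (hk : 0 < k)
    {X : EuclideanSpace ℝ (Fin (n + 1)) → EuclideanSpace ℝ (Fin (n + 1))}
    (hX : ContDiff ℝ (⊤ : ℕ∞) X) (hT : IsTangent n k X) (hK : IsKillingField n k X)
    (h0 : ∃ p ∈ Sph n k, X p ≠ 0) : energy n k X = (n - 1) * k ^ 2 := by
  have := energy_of_pointwise 1 one_ne_zero hk hX hT h0 ?_
  · rwa [one_mul] at this
  intro p hp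
  have hs := sph_inner hk hp
  have hskew : ∀ i j, aM k p (fderiv ℝ X p) i j = - aM k p (fderiv ℝ X p) j i := by
    intro i j
    have h := hK p hp (PPc k p (EuclideanSpace.single j 1)) (PPc k p (EuclideanSpace.single i 1))
      (PPc_orth hs _) (PPc_orth hs _)
    rw [covD_eq, covD_eq, covL_apply, covL_apply, ← PPc_sym, ← PPc_sym, PPc_idem hs, PPc_idem hs,
      PPc_idem hs, PPc_idem hs, inner_single_eq, inner_single_eq] at h
    simp only [aM, covL_apply]
    linarith
  have hd : ∀ i, aM k p (fderiv ℝ X p) i i = 0 := by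
    intro i
    linarith [hskew i i]
  simp only [hd, Finset.sum_const_zero]
  rw [covNormSq_eq, one_mul, zero_pow two_ne_zero, zero_sub, ← Finset.sum_neg_distrib]
  refine Finset.sum_congr rfl fun i _ => ?_
  rw [← Finset.sum_neg_distrib]
  refine Finset.sum_congr rfl fun j _ => ?_
  rw [hskew j i]
  ring

lemma part2 {n : ℕ} (hn : 2 ≤ n) {k : ℝ} (hk : 0 < k)
    (v : EuclideanSpace ℝ (Fin (n + 1))) (hv : v ≠ 0) :
    energy n k (fun p => v - (k ^ 2 * ⟪v, p⟫) • p) = k ^ 2 := by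
  set X : EuclideanSpace ℝ (Fin (n + 1)) → EuclideanSpace ℝ (Fin (n + 1)) :=
    fun p => v - (k ^ 2 * ⟪v, p⟫) • p with hXdef
  have hX : ContDiff ℝ (⊤ : ℕ∞) X := by
    rw [hXdef]; exact contDiff_const.sub ((contDiff_const.mul (contDiff_const.inner ℝ contDiff_id)).smul contDiff_id)
  have hT : IsTangent n k X := by
    intro p hp
    have := PPc_orth (sph_inner hk hp) v
    rwa [PPc_apply] at this
  have h0 : ∃ p ∈ Sph n k, X p ≠ 0 := by
    obtain ⟨w, hw, hwv⟩ : ∃ w : EuclideanSpace ℝ (Fin (n + 1)), w ≠ 0 ∧ ⟪v, w⟫ = 0 := by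
      by_contra! hcon
      have h1 : (Submodule.span ℝ {v})ᗮ = ⊥ := by
        rw [Submodule.eq_bot_iff]
        intro x hx
        by_contra hx0
        exact hcon x hx0 (Submodule.mem_orthogonal_singleton_iff_inner_right.1 hx)
      have h2 := Submodule.finrank_add_finrank_orthogonal (Submodule.span ℝ {v})
      rw [h1, finrank_bot, finrank_span_singleton hv, finrank_euclideanSpace_fin] at h2
      omega
    have hwn : 0 < ‖w‖ := norm_pos_iff.2 hw
    refine ⟨(k * ‖w‖)⁻¹ • w, ?_, ?_⟩
    · simp only [Sph, mem_sphere_iff_norm, sub_zero]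
      rw [norm_smul, Real.norm_eq_abs, abs_of_pos (by positivity)]
      field_simp
    · simp only [hXdef, inner_smul_right, hwv]
      simpa using hv
  have hn' : (2 : ℝ) ≤ n := by exact_mod_cast hn
  have hc : (n : ℝ) - 1 ≠ 0 := by linarith
  have key := energy_of_pointwise ((n : ℝ) - 1) hc hk hX hT h0 ?_
  · exact mul_left_cancel₀ hc key
  intro p hp
  have hs := sph_inner hk hp
  have hD : ∀ u, fderiv ℝ X p u = -((k ^ 2 * ⟪v, u⟫) • p + (k ^ 2 * ⟪v, p⟫) • u) := by
    intro u
    have h1 : HasFDerivAt (fun q => k ^ 2 * ⟪v, q⟫) (k ^ 2 • innerSL ℝ v) p :=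
      ((innerSL ℝ v).hasFDerivAt).const_mul (k ^ 2)
    have h2 : HasFDerivAt X _ p := (h1.smul (hasFDerivAt_id p)).const_sub v
    rw [h2.fderiv]
    simp
    abel
  have ha : ∀ i j, aM k p (fderiv ℝ X p) i j = -(k ^ 2 * ⟪v, p⟫) * pM k p i j := by
    intro i j
    rw [aM, covL_apply, hD, map_neg, map_add, map_smul, map_smul, PPc_self hs, PPc_idem hs]
    simp [pM_eq]
  rw [covNormSq_eq]
  simp only [ha, ← Finset.mul_sum, pM_trace hs, mul_pow, pM_sq hs]
  have h3 : ∑ i, ∑ j, -(k ^ 2 * ⟪v, p⟫) * pM k p i j * (-(k ^ 2 * ⟪v, p⟫) * pM k p j i) =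
      (k ^ 2 * ⟪v, p⟫) ^ 2 * n := by
    rw [← pM_sq hs, Finset.mul_sum]
    refine Finset.sum_congr rfl fun i _ => ?_
    rw [Finset.mul_sum]
    refine Finset.sum_congr rfl fun j _ => ?_
    rw [pM_symm k p j i]
    ring
  rw [h3]
  ring

end Helpers

/-- **Theorem `inf`.** The infimum of the energy functional
`F(X) = (∫‖∇X‖²)/(∫‖X‖²)` over all nonzero smooth vector fields on `S^n(1/k)`, `n ≥ 2`,
equals `k²`; it is attained by the pointwise orthogonal projection
`p ↦ v − k²⟨v,p⟩p` onto the tangent spaces of a constant nonzero vector field `v` of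
`ℝ^{n+1}`.  Moreover a Killing field of `S^n(1/k)` realizes the infimum `k²` if and
only if `n = 2`. -/
theorem energy_infimum_on_sphere
    (n : ℕ) (hn : 2 ≤ n) (k : ℝ) (hk : 0 < k) :
    (∀ X : EuclideanSpace ℝ (Fin (n + 1)) → EuclideanSpace ℝ (Fin (n + 1)),
        ContDiff ℝ (⊤ : ℕ∞) X → IsTangent n k X → (∃ p ∈ Sph n k, X p ≠ 0) →
        k ^ 2 ≤ energy n k X) ∧
    (∀ v : EuclideanSpace ℝ (Fin (n + 1)), v ≠ 0 →
        energy n k (fun p => v - (k ^ 2 * ⟪v, p⟫) • p) = k ^ 2) ∧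
    (∀ X : EuclideanSpace ℝ (Fin (n + 1)) → EuclideanSpace ℝ (Fin (n + 1)),
        ContDiff ℝ (⊤ : ℕ∞) X → IsTangent n k X → IsKillingField n k X →
        (∃ p ∈ Sph n k, X p ≠ 0) → (energy n k X = k ^ 2 ↔ n = 2)) := by
  refine ⟨fun X hX hT h0 => part1 hn hk hX hT h0, fun v hv => part2 hn hk v hv,
    fun X hX hT hK h0 => ?_⟩
  rw [part3 hk hX hT hK h0]
  constructor
  · intro h
    have h1 : (n : ℝ) - 1 = 1 := by
      have hk2 : k ^ 2 ≠ 0 := by positivity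
      exact mul_right_cancel₀ hk2 (by rw [h, one_mul])
    have h2 : (n : ℝ) = 2 := by linarith
    exact_mod_cast h2
  · intro h
    rw [h]
    push_cast
    ring
end
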